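/- Let T_1 = \vec T_1 ‖T_1‖, …, T_r = \vec T_r ‖T_r‖ be (d−1)-dimensional normal currents on ℝ^d without boundary, ∂T_i = 0 for i = 1,…,r, and let μ be a finite positive Radon measure on ℝ^d with μ ≪ ‖T_i‖ for i = 1,…,r. Then for μ^s-almost every x ∈ ℝ^d there exists a (d−1)-dimensional linear subspace V_x ⊂ ℝ^d such that \vec T_1(x), …, \vec T_r(x) ∈ Λ_{d−1}(V_x). -/

import Mathlib

open MeasureTheory Metric

/-- The partial derivative `∂_j φ` of a scalar function on `ℝ^d`. -/
noncomputable def pderiv' {d : ℕ} (j : Fin d) (φ : EuclideanSpace ℝ (Fin d) → ℝ) :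
    EuclideanSpace ℝ (Fin d) → ℝ :=
  fun x => fderiv ℝ φ x (EuclideanSpace.single j 1)

/-- The sign `ε(j,t)` with `dx^j ∧ dx^t = ε(j,t) dx^{t ∪ {j}}` (for `j ∉ t`). -/
def wedgeSign {d : ℕ} (j : Fin d) (t : Finset (Fin d)) : ℝ :=
  (-1 : ℝ) ^ (t.filter fun l => l < j).card

/-- The `k`-vector with coordinates `c` in the standard basis `(e_s)_{#s = k}` of
`Λ_k(ℝ^d)`, as an element of the exterior algebra:
`∑_{#s = k} c_s · e_{s(1)} ∧ ⋯ ∧ e_{s(k)}` (indices of `s` in increasing order). -/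
noncomputable def vecOfCoords {d : ℕ} (k : ℕ) (c : Finset (Fin d) → ℝ) :
    ExteriorAlgebra ℝ (EuclideanSpace ℝ (Fin d)) :=
  ∑ s : {s : Finset (Fin d) // s.card = k},
    c s.1 • ExteriorAlgebra.ιMulti ℝ k fun j =>
      EuclideanSpace.single (↑(s.1.orderIsoOfFin s.2 j) : Fin d) 1

/-- The set of simple `k`-vectors `v_1 ∧ ⋯ ∧ v_k` with all `v_j` in the subspace `V`;
its span is `Λ_k(V) ⊆ Λ_k(ℝ^d)`. -/
def simpleVectorsOf {d : ℕ} (k : ℕ) (V : Submodule ℝ (EuclideanSpace ℝ (Fin d))) :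
    Set (ExteriorAlgebra ℝ (EuclideanSpace ℝ (Fin d))) :=
  {w | ∃ v : Fin k → EuclideanSpace ℝ (Fin d),
    (∀ j, v j ∈ V) ∧ w = ExteriorAlgebra.ιMulti ℝ k v}

namespace RankOne

open Set Filter Topology
open scoped ENNReal NNReal InnerProductSpace Convolution

section Euclidean

variable {E : Type*} [NormedAddCommGroup E] [InnerProductSpace ℝ E] [FiniteDimensional ℝ E]
  [MeasurableSpace E] [BorelSpace E]

set_option linter.unusedSectionVars false

/-- The vector-valued measure `β σ` is curl-free in the sense of distributions. -/
def IsCurlFree (σ : Measure E) (β : E → E) : Prop :=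
  ∀ φ : E → ℝ, ContDiff ℝ (⊤ : ℕ∞) φ → HasCompactSupport φ → ∀ v w : E,
    ∫ x, (fderiv ℝ φ x v * ⟪β x, w⟫_ℝ - fderiv ℝ φ x w * ⟪β x, v⟫_ℝ) ∂σ = 0

/-- Mollification of the vector-valued measure `β σ` by the kernel `η`. -/
noncomputable def mollify (η : E → ℝ) (σ : Measure E) (β : E → E) (x : E) : E :=
  ∫ y, η (x - y) • β y ∂σ

theorem exists_norm_fderiv_le {η : E → ℝ} (hη : ContDiff ℝ (⊤ : ℕ∞) η)
    (hc : HasCompactSupport η) : ∃ C, ∀ x, ‖fderiv ℝ η x‖ ≤ C :=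
  (hc.fderiv ℝ).exists_bound_of_continuous (hη.continuous_fderiv (by simp))

section mollify

variable {η : E → ℝ} {σ : Measure E} [IsFiniteMeasure σ] {β : E → E}

theorem integrable_mollify (hη : ContDiff ℝ (⊤ : ℕ∞) η) (hc : HasCompactSupport η)
    (hβ : StronglyMeasurable β) (hβ1 : ∀ x, ‖β x‖ ≤ 1) (x : E) :
    Integrable (fun y => η (x - y) • β y) σ := by
  obtain ⟨C, hC⟩ := hc.exists_bound_of_continuous hη.continuous
  refine Integrable.of_bound (C := C) ?_ (Eventually.of_forall fun y => ?_)
  · exact ((hη.continuous.comp (continuous_const.sub continuous_id)).stronglyMeasurable.smul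
      hβ).aestronglyMeasurable
  · rw [norm_smul]
    calc ‖η (x - y)‖ * ‖β y‖ ≤ C * 1 :=
          mul_le_mul (hC _) (hβ1 _) (norm_nonneg _) ((norm_nonneg _).trans (hC 0))
      _ = C := mul_one C

theorem hasFDerivAt_mollify (hη : ContDiff ℝ (⊤ : ℕ∞) η) (hc : HasCompactSupport η)
    (hβ : StronglyMeasurable β) (hβ1 : ∀ x, ‖β x‖ ≤ 1) (x : E) :
    HasFDerivAt (mollify η σ β) (∫ y, (fderiv ℝ η (x - y)).smulRight (β y) ∂σ) x ∧
    Integrable (fun y => (fderiv ℝ η (x - y)).smulRight (β y)) σ := by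
  obtain ⟨C, hC⟩ := exists_norm_fderiv_le hη hc
  have hmeas : ∀ x, AEStronglyMeasurable (fun y => (fderiv ℝ η (x - y)).smulRight (β y)) σ := by
    intro x
    have h1 : StronglyMeasurable fun y => fderiv ℝ η (x - y) :=
      ((hη.continuous_fderiv (by simp)).comp
        (continuous_const.sub continuous_id)).stronglyMeasurable
    exact (((ContinuousLinearMap.smulRightL ℝ E E).continuous₂).comp_stronglyMeasurable
      (h1.prodMk hβ)).aestronglyMeasurable
  have hbd : ∀ x y, ‖(fderiv ℝ η (x - y)).smulRight (β y)‖ ≤ C := by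
    intro x y
    rw [ContinuousLinearMap.norm_smulRight_apply]
    calc _ ≤ C * 1 := mul_le_mul (hC _) (hβ1 _) (norm_nonneg _) ((norm_nonneg _).trans (hC 0))
      _ = C := mul_one C
  refine ⟨?_, Integrable.of_bound (C := C) (hmeas x) (Eventually.of_forall (hbd x))⟩
  refine hasFDerivAt_integral_of_dominated_of_fderiv_le (bound := fun _ => C) (s := univ) univ_mem
    (Eventually.of_forall fun x => (integrable_mollify hη hc hβ hβ1 x).aestronglyMeasurable)
    (integrable_mollify hη hc hβ hβ1 x) (hmeas x)
    (Eventually.of_forall fun y z _ => hbd z y) (integrable_const C)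
    (Eventually.of_forall fun y z _ => ?_)
  have h1 : HasFDerivAt (fun z => η (z - y)) (fderiv ℝ η (z - y)) z := by
    have := ((hη.differentiable (by simp)) (z - y)).hasFDerivAt.comp z
      ((hasFDerivAt_id z).sub_const y)
    simpa using! this
  exact h1.smul_const (β y)

theorem continuous_mollify (hη : ContDiff ℝ (⊤ : ℕ∞) η) (hc : HasCompactSupport η)
    (hβ : StronglyMeasurable β) (hβ1 : ∀ x, ‖β x‖ ≤ 1) : Continuous (mollify η σ β) :=
  continuous_iff_continuousAt.2 fun x => (hasFDerivAt_mollify hη hc hβ hβ1 x).1.continuousAt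

/-- The mollification of a curl-free vector-valued measure is a gradient. -/
theorem exists_potential_mollify (hη : ContDiff ℝ (⊤ : ℕ∞) η) (hc : HasCompactSupport η)
    (hβ : StronglyMeasurable β) (hβ1 : ∀ x, ‖β x‖ ≤ 1) (hcurl : IsCurlFree σ β) :
    ∃ u : E → ℝ, ∀ x, HasFDerivAt u (innerSL ℝ (mollify η σ β x)) x := by
  have key := fun x => hasFDerivAt_mollify (σ := σ) hη hc hβ hβ1 x
  have hD : ∀ x, HasFDerivAt (fun x => innerSL ℝ (mollify η σ β x))
      ((innerSL ℝ).comp (∫ y, (fderiv ℝ η (x - y)).smulRight (β y) ∂σ)) x := fun x =>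
    (innerSL ℝ (E := E)).hasFDerivAt.comp x (key x).1
  obtain ⟨u, hu⟩ := (convex_univ (𝕜 := ℝ) (E := E)).exists_forall_hasFDerivAt_of_fderiv_symmetric
    isOpen_univ (ω := fun x => innerSL ℝ (mollify η σ β x))
    (fun x _ => (hD x).differentiableAt.differentiableWithinAt)
    (fun x _ v w => by
      have hi : ∀ v, Integrable (fun y => (fderiv ℝ η (x - y)).smulRight (β y) v) σ := fun v =>
        (ContinuousLinearMap.apply ℝ E v).integrable_comp (key x).2
      have e : ∀ v w, fderiv ℝ (fun x => innerSL ℝ (mollify η σ β x)) x v w =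
          ∫ y, fderiv ℝ η (x - y) v * ⟪β y, w⟫_ℝ ∂σ := by
        intro v w
        rw [(hD x).fderiv, ContinuousLinearMap.comp_apply, innerSL_apply_apply,
          ContinuousLinearMap.integral_apply (key x).2, real_inner_comm, ← integral_inner (hi v)]
        simp only [ContinuousLinearMap.smulRight_apply, inner_smul_right, real_inner_comm]
      have hi2 : ∀ v w, Integrable (fun y => fderiv ℝ η (x - y) v * ⟪β y, w⟫_ℝ) σ := by
        intro v w
        have := (hi v).inner_const (𝕜 := ℝ) w
        simpa only [ContinuousLinearMap.smulRight_apply, real_inner_smul_left] using this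
      rw [e, e, ← sub_eq_zero, ← integral_sub (hi2 _ _) (hi2 _ _)]
      have h := hcurl (fun y => η (x - y)) (hη.comp (contDiff_const.sub contDiff_id))
        (hc.comp_homeomorph (Homeomorph.subLeft x)) w v
      rw [← h]
      refine integral_congr_ae (Eventually.of_forall fun y => ?_)
      have h1 : fderiv ℝ (fun y => η (x - y)) y = -fderiv ℝ η (x - y) := by
        have := ((hη.differentiable (by simp)) (x - y)).hasFDerivAt.comp y
          ((hasFDerivAt_id y).const_sub x)
        rw [show (fun y => η (x - y)) = η ∘ HSub.hSub x from rfl, HasFDerivAt.fderiv this]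
        ext; simp
      simp only [h1, neg_apply]
      ring)
  exact ⟨u, fun x => hu x (mem_univ x)⟩

end mollify

variable (E) in
/-- A fixed smooth bump function, equal to `1` on the ball of radius `3/4` and supported in the
unit ball. -/
noncomputable def stdBump : ContDiffBump (0 : E) := ⟨3 / 4, 1, by norm_num, by norm_num⟩

variable (E) in
/-- The maximum of the normalized bump function `stdBump`. -/
noncomputable def bumpMax : ℝ := (stdBump E).normed volume 0

theorem normed_stdBump_eq {z : E} (hz : ‖z‖ ≤ 3 / 4) : (stdBump E).normed volume z = bumpMax E := by
  have h1 : ∀ z : E, ‖z‖ ≤ 3 / 4 → stdBump E z = 1 := fun z hz =>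
    (stdBump E).one_of_mem_closedBall (by simpa [stdBump] using! hz)
  rw [bumpMax, ContDiffBump.normed_def, ContDiffBump.normed_def, h1 z hz, h1 0 (by norm_num)]

theorem normed_stdBump_le (z : E) : (stdBump E).normed volume z ≤ bumpMax E := by
  rw [bumpMax, ContDiffBump.normed_def, ContDiffBump.normed_def,
    (stdBump E).one_of_mem_closedBall (x := 0) (by simp [stdBump]; norm_num)]
  gcongr
  · exact (stdBump E).integral_pos.le
  · exact (stdBump E).le_one

theorem bumpMax_pos : 0 < bumpMax E := by
  rw [bumpMax, ContDiffBump.normed_def,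
    (stdBump E).one_of_mem_closedBall (x := 0) (by simp [stdBump]; norm_num)]
  exact div_pos one_pos (stdBump E).integral_pos

theorem normed_stdBump_eq_zero {z : E} (hz : 1 ≤ ‖z‖) : (stdBump E).normed volume z = 0 := by
  by_contra h
  have : z ∈ Function.support ((stdBump E).normed volume) := h
  rw [ContDiffBump.support_normed_eq] at this
  simp [stdBump] at this
  linarith

section kernel

variable {δ : ℝ} (f : ContDiffBump (0 : E)) (x y : E) {h : ℝ}

/-- Change of variables in the averaging kernel. -/
theorem kernel_eq (hh : 0 < h) :
    ∫ z, f.normed volume (x - h • z - y) * (stdBump E).normed volume z =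
      (h ^ Module.finrank ℝ E)⁻¹ *
        ∫ w, f.normed volume w * (stdBump E).normed volume (h⁻¹ • (x - y - w)) := by
  have h1 := Measure.integral_comp_smul (volume : Measure E)
    (fun w => f.normed volume (x - y - w) * (stdBump E).normed volume (h⁻¹ • w)) h
  have h2 := integral_sub_left_eq_self
    (fun w => f.normed volume w * (stdBump E).normed volume (h⁻¹ • (x - y - w))) volume (x - y)
  simp only [sub_sub_cancel] at h2
  rw [← h2]
  rw [abs_of_nonneg (by positivity), smul_eq_mul] at h1
  rw [← h1]
  congr 1; ext z
  rw [smul_smul, inv_mul_cancel₀ hh.ne', one_smul, sub_right_comm]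

theorem kernel_le (hh : 0 < h) :
    ∫ z, f.normed volume (x - h • z - y) * (stdBump E).normed volume z ≤
      bumpMax E * (h ^ Module.finrank ℝ E)⁻¹ := by
  rw [kernel_eq f x y hh, mul_comm]
  gcongr
  calc _ ≤ ∫ w, f.normed volume w * bumpMax E := by
        refine integral_mono_of_nonneg (Eventually.of_forall fun w => ?_)
          (f.integrable_normed.mul_const _) (Eventually.of_forall fun w => ?_)
        · exact mul_nonneg (f.nonneg_normed _) ((stdBump E).nonneg_normed _)
        · exact mul_le_mul_of_nonneg_left (normed_stdBump_le _) (f.nonneg_normed _)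
    _ = bumpMax E := by rw [integral_mul_const, f.integral_normed, one_mul]

theorem kernel_nonneg :
    0 ≤ ∫ z, f.normed volume (x - h • z - y) * (stdBump E).normed volume z :=
  integral_nonneg fun _ => mul_nonneg (f.nonneg_normed _) ((stdBump E).nonneg_normed _)

theorem normed_eq_zero_of_rOut_le {w : E} (hw : f.rOut ≤ ‖w‖) : f.normed volume w = 0 := by
  by_contra h
  have : w ∈ Function.support (f.normed volume) := h
  rw [ContDiffBump.support_normed_eq] at this
  simp at this
  linarith

theorem kernel_eq_zero (hh : 0 < h) (hf : f.rOut ≤ h / 4) (hxy : 2 * h < ‖x - y‖) :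
    ∫ z, f.normed volume (x - h • z - y) * (stdBump E).normed volume z = 0 := by
  refine integral_eq_zero_of_ae (Eventually.of_forall fun z => ?_)
  show f.normed volume (x - h • z - y) * (stdBump E).normed volume z = 0
  by_cases hz : 1 ≤ ‖z‖
  · rw [normed_stdBump_eq_zero hz, mul_zero]
  · rw [normed_eq_zero_of_rOut_le, zero_mul]
    have h1 : ‖h • z‖ ≤ h := by
      rw [norm_smul, Real.norm_of_nonneg hh.le]; nlinarith
    have h2 : ‖x - y‖ ≤ ‖x - h • z - y‖ + ‖h • z‖ := by
      calc ‖x - y‖ = ‖(x - h • z - y) + h • z‖ := by congr 1; abel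
        _ ≤ _ := norm_add_le _ _
    linarith

theorem le_kernel (hh : 0 < h) (hf : f.rOut ≤ h / 4) (hxy : ‖x - y‖ ≤ h / 2) :
    bumpMax E * (h ^ Module.finrank ℝ E)⁻¹ ≤
    ∫ z, f.normed volume (x - h • z - y) * (stdBump E).normed volume z := by
  rw [kernel_eq f x y hh, mul_comm]
  refine mul_le_mul_of_nonneg_left (le_of_eq ?_) (by positivity)
  calc bumpMax E = ∫ w, f.normed volume w * bumpMax E := by
        rw [integral_mul_const, f.integral_normed, one_mul]
    _ = _ := by
      congr 1; ext w
      by_cases hw : f.rOut ≤ ‖w‖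
      · rw [normed_eq_zero_of_rOut_le f hw, zero_mul, zero_mul]
      · rw [normed_stdBump_eq]
        rw [norm_smul, norm_inv, Real.norm_of_nonneg hh.le, inv_mul_le_iff₀ hh]
        have := norm_sub_le (x - y) w
        linarith

end kernel

section

variable {σ : Measure E} [IsFiniteMeasure σ] {β : E → E}

theorem integral_kernel_swap (f : ContDiffBump (0 : E)) (x : E) (h : ℝ) {g : E → ℝ}
    (hg : StronglyMeasurable g) {C : ℝ} (hC : ∀ y, ‖g y‖ ≤ C) :
    Integrable (fun z => (stdBump E).normed volume z *
      ∫ y, f.normed volume (x - h • z - y) * g y ∂σ) ∧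
    Integrable (fun y => (∫ z, f.normed volume (x - h • z - y) * (stdBump E).normed volume z) *
      g y) σ ∧
    ∫ z, (stdBump E).normed volume z * ∫ y, f.normed volume (x - h • z - y) * g y ∂σ =
      ∫ y, (∫ z, f.normed volume (x - h • z - y) * (stdBump E).normed volume z) * g y ∂σ := by
  have hint : Integrable (fun p : E × E => (stdBump E).normed volume p.1 *
      (f.normed volume (x - h • p.1 - p.2) * g p.2)) (volume.prod σ) := by
    obtain ⟨A, hA⟩ := f.hasCompactSupport_normed.exists_bound_of_continuous
      (f.continuous_normed (μ := volume))
    have h1 : Integrable (fun p : E × E => (stdBump E).normed volume p.1) (volume.prod σ) :=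
      (stdBump E).integrable_normed.comp_fst σ
    refine h1.mul_bdd (c := A * C) ?_ (Eventually.of_forall fun p => ?_)
    · exact (((f.continuous_normed (μ := volume)).comp (by fun_prop :
        Continuous fun p : E × E => x - h • p.1 - p.2)).stronglyMeasurable.mul
        (hg.comp_measurable measurable_snd)).aestronglyMeasurable
    · rw [norm_mul]
      exact mul_le_mul (hA _) (hC _) (norm_nonneg _) ((norm_nonneg _).trans (hA 0))
  have e1 : ∀ z, ∫ y, (stdBump E).normed volume z * (f.normed volume (x - h • z - y) * g y) ∂σ =
      (stdBump E).normed volume z * ∫ y, f.normed volume (x - h • z - y) * g y ∂σ :=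
    fun z => integral_const_mul _ _
  have e2 : ∀ y, ∫ z, (stdBump E).normed volume z * (f.normed volume (x - h • z - y) * g y) =
      (∫ z, f.normed volume (x - h • z - y) * (stdBump E).normed volume z) * g y := by
    intro y
    rw [← integral_mul_const]
    congr 1; ext z; ring
  refine ⟨?_, ?_, ?_⟩
  · simpa only [e1] using hint.integral_prod_left
  · simpa only [e2] using hint.integral_prod_right
  · have := integral_integral_swap (f := fun z y => (stdBump E).normed volume z *
      (f.normed volume (x - h • z - y) * g y)) hint
    simpa only [e1, e2] using this

/-- Mollification of a curl-free vector-valued measure at a variable scale `h`. -/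
theorem exists_variable_mollification (hβ : StronglyMeasurable β) (hβ1 : ∀ x, ‖β x‖ ≤ 1)
    (hcurl : IsCurlFree σ β) {h : E → ℝ} (hh : ContDiff ℝ 1 h) {h₀ κ : ℝ} (h₀pos : 0 < h₀)
    (hh₀ : ∀ x, h₀ ≤ h x) (hκ1 : κ ≤ 1) (hκ : ∀ x, ‖fderiv ℝ h x‖ ≤ κ) :
    ∃ φ : E → ℝ, ContDiff ℝ 1 φ ∧
      (∀ x b v, ‖v‖ ≤ 1 → κ ≤ ⟪b, v⟫_ℝ →
        bumpMax E * (h x ^ Module.finrank ℝ E)⁻¹ * ((⟪b, v⟫_ℝ - κ) * σ.real (closedBall x (h x / 2))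
          - ∫ y in closedBall x (2 * h x), ‖β y - b‖ ∂σ) ≤ fderiv ℝ φ x v) ∧
      ∀ x, ‖fderiv ℝ φ x‖ ≤
        2 * (bumpMax E * (h x ^ Module.finrank ℝ E)⁻¹ * σ.real (closedBall x (2 * h x))) := by
  let f : ContDiffBump (0 : E) := ⟨h₀ / 8, h₀ / 4, by positivity, by linarith⟩
  have hf : ∀ x, f.rOut ≤ h x / 4 := fun x => by
    show h₀ / 4 ≤ _
    linarith [hh₀ x]
  set ηd := f.normed volume with hηd
  set η := (stdBump E).normed volume with hη
  have hηds : ContDiff ℝ (⊤ : ℕ∞) ηd := f.contDiff_normed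
  have hηdc : HasCompactSupport ηd := f.hasCompactSupport_normed
  have hhpos : ∀ x, 0 < h x := fun x => h₀pos.trans_le (hh₀ x)
  obtain ⟨u, hu⟩ := exists_potential_mollify hηds hηdc hβ hβ1 hcurl
  set m := mollify ηd σ β with hm
  have hmc : Continuous m := continuous_mollify hηds hηdc hβ hβ1
  have hmle : ∀ x, ‖m x‖ ≤ ∫ y, ηd (x - y) * 1 ∂σ := by
    intro x
    refine norm_integral_le_of_norm_le ?_ (Eventually.of_forall fun y => ?_)
    · obtain ⟨C, hC⟩ := hηdc.exists_bound_of_continuous hηds.continuous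
      refine Integrable.of_bound (C := C) ?_ (Eventually.of_forall fun y => ?_)
      · exact (by fun_prop : Continuous fun y => ηd (x - y) * 1).aestronglyMeasurable
      · rw [mul_one]; exact hC _
    · rw [norm_smul, Real.norm_of_nonneg (f.nonneg_normed _)]
      exact mul_le_mul_of_nonneg_left (hβ1 y) (f.nonneg_normed _)
  obtain ⟨A, hA⟩ : ∃ A, ∀ x, ‖m x‖ ≤ A := by
    obtain ⟨C, hC⟩ := hηdc.exists_bound_of_continuous hηds.continuous
    refine ⟨C * σ.real univ, fun x => ?_⟩
    refine norm_integral_le_of_norm_le_const (Eventually.of_forall fun y => ?_)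
    rw [norm_smul]
    calc _ ≤ C * 1 := mul_le_mul (hC _) (hβ1 _) (norm_nonneg _) ((norm_nonneg _).trans (hC 0))
      _ = C := mul_one C
  have hA0 : 0 ≤ A := (norm_nonneg _).trans (hA 0)
  have hκ0 : 0 ≤ κ := (norm_nonneg _).trans (hκ 0)
  have huc : Continuous u := continuous_iff_continuousAt.2 fun x => (hu x).continuousAt
  have hhc : Continuous h := hh.continuous
  have hhd : Continuous (fderiv ℝ h) := hh.continuous_fderiv (by simp)
  -- the derivative of `x ↦ η z * u (x - h x z)`
  let D : E → E → (E →L[ℝ] ℝ) := fun x z =>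
    η z • (innerSL ℝ (m (x - h x • z))).comp
      (ContinuousLinearMap.id ℝ E - (fderiv ℝ h x).smulRight z)
  have hDc : Continuous fun p : E × E => D p.1 p.2 := by
    have hηc : Continuous η := (stdBump E).continuous_normed
    have h1 : Continuous fun p : E × E => (fderiv ℝ h p.1).smulRight p.2 :=
      ((ContinuousLinearMap.smulRightL ℝ E E).continuous₂).comp
        ((hhd.comp continuous_fst).prodMk continuous_snd)
    have h2 : Continuous fun p : E × E => innerSL ℝ (m (p.1 - h p.1 • p.2)) :=
      (innerSL ℝ).continuous.comp (by fun_prop)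
    exact (hηc.comp continuous_snd).smul (h2.clm_comp (continuous_const.sub h1))
  have hDnorm : ∀ x z, ‖D x z‖ ≤ η z * (‖m (x - h x • z)‖ * 2) := by
    intro x z
    rw [norm_smul, Real.norm_of_nonneg ((stdBump E).nonneg_normed _)]
    by_cases hz : 1 ≤ ‖z‖
    · rw [hη, normed_stdBump_eq_zero hz]; simp
    · refine mul_le_mul_of_nonneg_left ?_ ((stdBump E).nonneg_normed _)
      refine (ContinuousLinearMap.opNorm_comp_le _ _).trans ?_
      rw [innerSL_apply_norm]
      refine mul_le_mul_of_nonneg_left ?_ (norm_nonneg _)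
      refine (norm_sub_le _ _).trans ?_
      rw [ContinuousLinearMap.norm_smulRight_apply]
      have h1 : ‖ContinuousLinearMap.id ℝ E‖ ≤ 1 := ContinuousLinearMap.norm_id_le
      have h2 : ‖fderiv ℝ h x‖ * ‖z‖ ≤ 1 * 1 :=
        mul_le_mul ((hκ x).trans hκ1) (not_le.1 hz).le (norm_nonneg _) zero_le_one
      linarith
  have hDbd : ∀ x z, ‖D x z‖ ≤ η z * (A * 2) := fun x z =>
    (hDnorm x z).trans (mul_le_mul_of_nonneg_left (by linarith [hA (x - h x • z)])
      ((stdBump E).nonneg_normed _))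
  have hηi : Integrable η volume := (stdBump E).integrable_normed
  have hFi : ∀ x, Integrable (fun z => η z * u (x - h x • z)) volume := fun x =>
    Continuous.integrable_of_hasCompactSupport
      ((stdBump E).continuous_normed.mul (by fun_prop))
      ((stdBump E).hasCompactSupport_normed.mul_right)
  have hDi : ∀ x, Integrable (D x) volume := fun x =>
    (hηi.mul_const (A * 2)).mono'
      (hDc.comp (by fun_prop : Continuous fun z => (x, z))).aestronglyMeasurable
      (Eventually.of_forall (hDbd x))
  have hder : ∀ x, HasFDerivAt (fun x => ∫ z, η z * u (x - h x • z)) (∫ z, D x z) x := by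
    intro x
    refine hasFDerivAt_integral_of_dominated_of_fderiv_le (bound := fun z => η z * (A * 2))
      (s := univ) univ_mem (Eventually.of_forall fun x => (hFi x).aestronglyMeasurable) (hFi x)
      (hDi x).aestronglyMeasurable (Eventually.of_forall fun z x _ => hDbd x z)
      (hηi.mul_const _) (Eventually.of_forall fun z x _ => ?_)
    have h1 : HasFDerivAt (fun x => x - h x • z)
        (ContinuousLinearMap.id ℝ E - (fderiv ℝ h x).smulRight z) x :=
      (hasFDerivAt_id x).sub (((hh.differentiable (by simp)) x).hasFDerivAt.smul_const z)
    exact ((hu _).comp x h1).const_mul (η z)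
  have hfd : fderiv ℝ (fun x => ∫ z, η z * u (x - h x • z)) = fun x => ∫ z, D x z :=
    funext fun x => (hder x).fderiv
  refine ⟨fun x => ∫ z, η z * u (x - h x • z), ?_, ?_, ?_⟩
  · rw [contDiff_one_iff_fderiv, hfd]
    refine ⟨fun x => (hder x).differentiableAt, ?_⟩
    exact continuous_of_dominated (fun x => (hDi x).aestronglyMeasurable)
      (fun x => Eventually.of_forall (hDbd x)) (hηi.mul_const _)
      (Eventually.of_forall fun z => hDc.comp (by fun_prop : Continuous fun x => (x, z)))
  · intro x b v hv hbv
    have hgm : StronglyMeasurable fun y => ⟪b, v⟫_ℝ - κ - ‖β y - b‖ :=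
      (stronglyMeasurable_const).sub (hβ.sub stronglyMeasurable_const).norm
    have hnb : ∀ y, ‖β y - b‖ ≤ 1 + ‖b‖ := fun y =>
      (norm_sub_le _ _).trans (by linarith [hβ1 y])
    have hgb : ∀ y, ‖⟪b, v⟫_ℝ - κ - ‖β y - b‖‖ ≤ |⟪b, v⟫_ℝ - κ| + (1 + ‖b‖) := by
      intro y
      refine (norm_sub_le _ _).trans ?_
      rw [norm_norm, Real.norm_eq_abs]
      linarith [hnb y]
    obtain ⟨i1, i2, i3⟩ := integral_kernel_swap (σ := σ) f x (h x) hgm hgb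
    have hlow : ∫ z, η z * ∫ y, ηd (x - h x • z - y) * (⟪b, v⟫_ℝ - κ - ‖β y - b‖) ∂σ ≤
        fderiv ℝ (fun x => ∫ z, η z * u (x - h x • z)) x v := by
      rw [hfd]
      show _ ≤ (∫ z, D x z) v
      rw [ContinuousLinearMap.integral_apply (hDi x)]
      refine integral_mono i1 ((ContinuousLinearMap.apply ℝ ℝ v).integrable_comp (hDi x)) ?_
      intro z
      show _ ≤ η z * ⟪m (x - h x • z), v - fderiv ℝ h x v • z⟫_ℝ
      by_cases hz : 1 ≤ ‖z‖
      · rw [hη]; simp only [normed_stdBump_eq_zero hz, zero_mul, le_refl]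
      · refine mul_le_mul_of_nonneg_left ?_ ((stdBump E).nonneg_normed _)
        have hmi := integrable_mollify (σ := σ) hηds hηdc hβ hβ1 (x - h x • z)
        rw [hm, mollify, real_inner_comm (v - fderiv ℝ h x v • z), ← integral_inner hmi]
        refine integral_mono ?_ (hmi.const_inner _) ?_
        · obtain ⟨C, hC⟩ := hηdc.exists_bound_of_continuous hηds.continuous
          refine Integrable.of_bound (C := C * (|⟪b, v⟫_ℝ - κ| + (1 + ‖b‖))) ?_
            (Eventually.of_forall fun y => ?_)
          · exact ((by fun_prop : Continuous fun y => ηd (x - h x • z - y)).stronglyMeasurable.mul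
              hgm).aestronglyMeasurable
          · rw [norm_mul]
            exact mul_le_mul (hC _) (hgb y) (norm_nonneg _) ((norm_nonneg _).trans (hC 0))
        · intro y
          simp only [inner_smul_right]
          refine mul_le_mul_of_nonneg_left ?_ (f.nonneg_normed _)
          have e : ⟪v - fderiv ℝ h x v • z, β y⟫_ℝ =
              ⟪b, v⟫_ℝ + ⟪v, β y - b⟫_ℝ - fderiv ℝ h x v * ⟪z, β y⟫_ℝ := by
            rw [inner_sub_left, inner_sub_right, real_inner_smul_left, real_inner_comm b v]; ring
          rw [e]
          have h1 : |⟪v, β y - b⟫_ℝ| ≤ 1 * ‖β y - b‖ :=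
            (abs_real_inner_le_norm _ _).trans (mul_le_mul_of_nonneg_right hv (norm_nonneg _))
          have h2 : |⟪z, β y⟫_ℝ| ≤ 1 * 1 :=
            (abs_real_inner_le_norm _ _).trans
              (mul_le_mul (not_le.1 hz).le (hβ1 y) (norm_nonneg _) zero_le_one)
          have h3 : |fderiv ℝ h x v| ≤ κ * 1 :=
            ((fderiv ℝ h x).le_opNorm v).trans (mul_le_mul (hκ x) hv (norm_nonneg _) hκ0)
          have h4 : |fderiv ℝ h x v * ⟪z, β y⟫_ℝ| ≤ κ * 1 * (1 * 1) := by
            rw [abs_mul]; exact mul_le_mul h3 h2 (abs_nonneg _) (by linarith)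
          have h5 := abs_le.1 h1
          have h6 := abs_le.1 h4
          linarith [h5.1, h6.2]
    refine le_trans ?_ hlow
    rw [i3]
    set M := bumpMax E * (h x ^ Module.finrank ℝ E)⁻¹ with hM
    have hM0 : 0 ≤ M := mul_nonneg bumpMax_pos.le (inv_nonneg.2 (pow_nonneg (hhpos x).le _))
    have c0 : 0 ≤ ⟪b, v⟫_ℝ - κ := by linarith
    have hbi : Integrable (fun y => ‖β y - b‖) σ :=
      Integrable.of_bound (C := 1 + ‖b‖) (hβ.sub stronglyMeasurable_const).norm.aestronglyMeasurable
        (Eventually.of_forall fun y => by rw [norm_norm]; exact hnb y)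
    have e1 : M * ((⟪b, v⟫_ℝ - κ) * σ.real (closedBall x (h x / 2))
          - ∫ y in closedBall x (2 * h x), ‖β y - b‖ ∂σ) =
        ∫ y, ((closedBall x (h x / 2)).indicator (fun _ => M * (⟪b, v⟫_ℝ - κ)) y -
          (closedBall x (2 * h x)).indicator (fun y => M * ‖β y - b‖) y) ∂σ := by
      rw [integral_sub, integral_indicator measurableSet_closedBall,
        integral_indicator measurableSet_closedBall, setIntegral_const, integral_const_mul,
        smul_eq_mul]
      · ring
      · exact (integrable_const _).indicator measurableSet_closedBall
      · exact (hbi.const_mul M).indicator measurableSet_closedBall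
    rw [e1]
    refine integral_mono (((integrable_const _).indicator measurableSet_closedBall).sub
      ((hbi.const_mul M).indicator measurableSet_closedBall)) i2 fun y => ?_
    have k0 := kernel_nonneg f x y (h := h x)
    have k1 := kernel_le f x y (hhpos x)
    simp only
    rw [mul_sub (∫ z, f.normed volume (x - h x • z - y) * (stdBump E).normed volume z)]
    refine sub_le_sub ?_ ?_
    · by_cases hy : y ∈ closedBall x (h x / 2)
      · rw [indicator_of_mem hy]
        refine mul_le_mul_of_nonneg_right ?_ c0
        exact le_kernel f x y (hhpos x) (hf x)
          (by rw [mem_closedBall, dist_eq_norm, norm_sub_rev] at hy; exact hy)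
      · rw [indicator_of_notMem hy]
        exact mul_nonneg k0 c0
    · by_cases hy : y ∈ closedBall x (2 * h x)
      · rw [indicator_of_mem hy]
        exact mul_le_mul_of_nonneg_right k1 (norm_nonneg _)
      · rw [indicator_of_notMem hy, kernel_eq_zero f x y (hhpos x) (hf x), zero_mul]
        rw [mem_closedBall, dist_eq_norm, norm_sub_rev, not_le] at hy
        exact hy
  · intro x
    obtain ⟨i1, i2, i3⟩ := integral_kernel_swap (σ := σ) f x (h x) (g := fun _ => 1)
      stronglyMeasurable_const (C := 1) (fun _ => by simp)
    rw [hfd]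
    have s1 : ‖∫ z, D x z‖ ≤ ∫ z, (η z * ∫ y, ηd (x - h x • z - y) * 1 ∂σ) * 2 := by
      refine norm_integral_le_of_norm_le (i1.mul_const 2) (Eventually.of_forall fun z => ?_)
      refine (hDnorm x z).trans ?_
      rw [← mul_assoc]
      exact mul_le_mul_of_nonneg_right (mul_le_mul_of_nonneg_left (hmle _)
        ((stdBump E).nonneg_normed _)) zero_le_two
    refine s1.trans ?_
    rw [integral_mul_const, i3, mul_comm]
    refine mul_le_mul_of_nonneg_left ?_ zero_le_two
    set M := bumpMax E * (h x ^ Module.finrank ℝ E)⁻¹ with hM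
    have e1 : M * σ.real (closedBall x (2 * h x)) =
        ∫ y, (closedBall x (2 * h x)).indicator (fun _ => M) y ∂σ := by
      rw [integral_indicator measurableSet_closedBall, setIntegral_const, smul_eq_mul, mul_comm]
    rw [e1]
    refine integral_mono i2 ((integrable_const _).indicator measurableSet_closedBall) fun y => ?_
    simp only [mul_one]
    by_cases hy : y ∈ closedBall x (2 * h x)
    · rw [indicator_of_mem hy]
      exact kernel_le f x y (hhpos x)
    · rw [indicator_of_notMem hy, kernel_eq_zero f x y (hhpos x) (hf x)]
      rw [mem_closedBall, dist_eq_norm, norm_sub_rev, not_le] at hy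
      exact hy

end

theorem lintegral_eq_zero_of_forall {α : Type*} [MeasurableSpace α] {μ : Measure α}
    {f : α → ℝ≥0∞} (h : ∀ x, f x = 0) : ∫⁻ x, f x ∂μ = 0 := by
  simp only [h, lintegral_zero]

theorem lintegral_averaged_le {σ τ : Measure E} [SFinite σ] [SFinite τ] {h : E → ℝ}
    (hc : Continuous h) (hpos : ∀ x, 0 < h x) {B B' : Set E} (hB : MeasurableSet B)
    (hB' : MeasurableSet B')
    (hcomp : ∀ x ∈ B, ∀ y, dist y x ≤ 2 * h x → y ∈ B' ∧ h y ≤ 2 * h x ∧ dist x y ≤ 4 * h y)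
    {Θ : ℝ} (hΘ : ∀ y ∈ B',
      τ (closedBall y (4 * h y)) ≤ ENNReal.ofReal (Θ * h y ^ Module.finrank ℝ E))
    {g : E → ℝ≥0∞} (hg : Measurable g) :
    ∫⁻ x in B, ENNReal.ofReal (h x ^ Module.finrank ℝ E)⁻¹ *
      ∫⁻ y in closedBall x (2 * h x), g y ∂σ ∂τ ≤
      ENNReal.ofReal (2 ^ Module.finrank ℝ E * Θ) * ∫⁻ y in B', g y ∂σ := by
  set n := Module.finrank ℝ E with hn
  set S : Set (E × E) := {p | dist p.2 p.1 ≤ 2 * h p.1} ∩ B ×ˢ univ with hS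
  have hSm : MeasurableSet S :=
    (isClosed_le (by fun_prop) (by fun_prop)).measurableSet.inter (hB.prod MeasurableSet.univ)
  set F : E × E → ℝ≥0∞ := S.indicator fun p => ENNReal.ofReal (h p.1 ^ n)⁻¹ * g p.2 with hF
  have hhm : Measurable fun x => ENNReal.ofReal (h x ^ n)⁻¹ :=
    (hc.measurable.pow_const n).inv.ennreal_ofReal
  have hFm : Measurable F :=
    ((hhm.comp measurable_fst).mul (hg.comp measurable_snd)).indicator hSm
  have e1 : ∫⁻ x in B, ENNReal.ofReal (h x ^ n)⁻¹ * ∫⁻ y in closedBall x (2 * h x), g y ∂σ ∂τ =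
      ∫⁻ x, ∫⁻ y, F (x, y) ∂σ ∂τ := by
    rw [← lintegral_indicator hB]
    congr 1; ext x
    by_cases hx : x ∈ B
    · rw [indicator_of_mem hx, ← lintegral_indicator measurableSet_closedBall,
        ← lintegral_const_mul _ (hg.indicator measurableSet_closedBall)]
      congr 1; ext y
      by_cases hy : dist y x ≤ 2 * h x
      · have hS' : (x, y) ∈ S := ⟨hy, hx, mem_univ _⟩
        rw [indicator_of_mem (mem_closedBall.2 hy), hF, indicator_of_mem hS']
      · have hS' : (x, y) ∉ S := fun h => hy h.1
        rw [indicator_of_notMem (fun h => hy (mem_closedBall.1 h)), hF, indicator_of_notMem hS',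
          mul_zero]
    · rw [indicator_of_notMem hx]
      exact (lintegral_eq_zero_of_forall fun y => indicator_of_notMem (fun h => hx h.2.1) _).symm
  rw [e1, lintegral_lintegral_swap (f := fun x y => F (x, y)) hFm.aemeasurable,
    ← lintegral_const_mul _ hg,
    ← lintegral_indicator hB']
  refine lintegral_mono fun y => ?_
  by_cases hy : y ∈ B'
  · rw [indicator_of_mem hy]
    calc ∫⁻ x, F (x, y) ∂τ ≤ ∫⁻ x, (closedBall y (4 * h y)).indicator
          (fun _ => ENNReal.ofReal (2 ^ n * (h y ^ n)⁻¹) * g y) x ∂τ := by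
          refine lintegral_mono fun x => ?_
          by_cases hxy : (x, y) ∈ S
          · obtain ⟨_, h2, h3⟩ := hcomp x hxy.2.1 y hxy.1
            rw [hF, indicator_of_mem hxy, indicator_of_mem (mem_closedBall.2 h3)]
            refine mul_le_mul_left (ENNReal.ofReal_le_ofReal ?_) _
            have p1 := pow_pos (hpos x) n
            have p2 := pow_pos (hpos y) n
            have h4 : h y ^ n ≤ 2 ^ n * h x ^ n := by
              rw [← mul_pow]; exact pow_le_pow_left₀ (hpos y).le h2 n
            rw [← div_eq_mul_inv, inv_eq_one_div, div_le_div_iff₀ p1 p2]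
            linarith
          · rw [hF, indicator_of_notMem hxy]; exact zero_le
      _ = ENNReal.ofReal (2 ^ n * (h y ^ n)⁻¹) * g y * τ (closedBall y (4 * h y)) := by
          rw [lintegral_indicator measurableSet_closedBall, setLIntegral_const]
      _ ≤ ENNReal.ofReal (2 ^ n * (h y ^ n)⁻¹) * g y * ENNReal.ofReal (Θ * h y ^ n) :=
          mul_le_mul_right (hΘ y hy) _
      _ = ENNReal.ofReal (2 ^ n * Θ) * g y := by
          have p2 := pow_pos (hpos y) n
          rw [mul_right_comm, ← ENNReal.ofReal_mul (by positivity)]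
          congr 2
          field_simp
  · rw [indicator_of_notMem hy, nonpos_iff_eq_zero]
    exact lintegral_eq_zero_of_forall fun x =>
      indicator_of_notMem (fun h => hy (hcomp x h.2.1 y h.1).1) _

theorem sq_lintegral_le {α : Type*} [MeasurableSpace α] {μ : Measure α} {w : α → ℝ≥0∞}
    (hw : Measurable w) {Ω : Set α} (hΩ : ∀ x ∉ Ω, w x = 0) :
    (∫⁻ x, w x ∂μ) ^ 2 ≤ μ Ω * ∫⁻ x, w x ^ 2 ∂μ := by
  set U := toMeasurable μ Ω with hU
  have hUm : MeasurableSet U := measurableSet_toMeasurable _ _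
  have e1 : ∫⁻ x, w x ∂μ = ∫⁻ x, (U.indicator (fun _ => (1 : ℝ≥0∞)) * w : α → ℝ≥0∞) x ∂μ := by
    congr 1; ext x
    by_cases hx : x ∈ U
    · simp [hx]
    · simp [hx, hΩ x fun h => hx (subset_toMeasurable _ _ h)]
  have hh := ENNReal.lintegral_mul_le_Lp_mul_Lq μ (p := 2) (q := 2)
    Real.HolderConjugate.two_two (f := U.indicator fun _ => 1) (g := w)
    (measurable_const.indicator hUm).aemeasurable hw.aemeasurable
  rw [← e1] at hh
  have e2 : ∫⁻ x, (U.indicator (fun _ => (1 : ℝ≥0∞)) x) ^ (2 : ℝ) ∂μ = μ Ω := by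
    rw [← measure_toMeasurable Ω, ← lintegral_indicator_one hUm]
    congr 1; ext x
    by_cases hx : x ∈ U <;> simp [hx]
  rw [e2] at hh
  have h3 := pow_le_pow_left₀ zero_le hh 2
  refine h3.trans (le_of_eq ?_)
  rw [mul_pow, ← ENNReal.rpow_natCast, ← ENNReal.rpow_natCast, ← ENNReal.rpow_mul,
    ← ENNReal.rpow_mul]
  norm_num

theorem energy_lower_bound {σ : Measure E} [SFinite σ] {h : E → ℝ}
    (hc : Continuous h) (hpos : ∀ x, 0 < h x) {K Ω : Set E} (hK : MeasurableSet K)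
    (hsub : ∀ x ∈ K, ball x (h x / 8) ⊆ Ω)
    (hcomp : ∀ x ∈ K, ∀ y ∈ K, dist x y < h x / 8 + h y / 8 → h y ≤ 2 * h x) :
    volume (ball (0 : E) (1 / 8)) * σ K ^ 2 ≤
      volume Ω * ∫⁻ x in K, ENNReal.ofReal (h x ^ Module.finrank ℝ E)⁻¹ *
        σ (closedBall x (h x / 2) ∩ K) ∂σ := by
  set n := Module.finrank ℝ E with hn
  set c := volume (ball (0 : E) (1 / 8)) with hcdef
  have hc0 : c ≠ 0 := (measure_ball_pos _ _ (by norm_num)).ne'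
  have hct : c ≠ ∞ := measure_ball_lt_top.ne
  set S : Set (E × E) := {p | dist p.2 p.1 < h p.1 / 8} ∩ K ×ˢ univ with hS
  have hSm : MeasurableSet S :=
    (isOpen_lt (by fun_prop) (by fun_prop)).measurableSet.inter (hK.prod MeasurableSet.univ)
  set p : E × E → ℝ≥0∞ := S.indicator fun p => ENNReal.ofReal (h p.1 ^ n)⁻¹ with hp
  have hhm : Measurable fun x => ENNReal.ofReal (h x ^ n)⁻¹ :=
    (hc.measurable.pow_const n).inv.ennreal_ofReal
  have hpm : Measurable p := (hhm.comp measurable_fst).indicator hSm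
  have hpl : ∀ x, Measurable fun z => p (x, z) := fun x => hpm.comp measurable_prodMk_left
  have hpr : ∀ z, Measurable fun x => p (x, z) := fun z => hpm.comp measurable_prodMk_right
  set w : E → ℝ≥0∞ := fun z => ∫⁻ x, p (x, z) ∂σ with hw
  have hwm : Measurable w := hpm.lintegral_prod_left'
  have hz : ∀ x, ∫⁻ z, p (x, z) = K.indicator (fun _ => c) x := by
    intro x
    by_cases hx : x ∈ K
    · have e : ∀ z, p (x, z) = (ball x (h x / 8)).indicator
          (fun _ => ENNReal.ofReal (h x ^ n)⁻¹) z := by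
        intro z
        by_cases hz : dist z x < h x / 8
        · rw [indicator_of_mem (mem_ball.2 hz), hp, indicator_of_mem]
          exact ⟨hz, hx, mem_univ _⟩
        · rw [indicator_of_notMem (fun h => hz (mem_ball.1 h)), hp, indicator_of_notMem]
          exact fun h => hz h.1
      simp only [e]
      rw [indicator_of_mem hx, lintegral_indicator measurableSet_ball, setLIntegral_const,
        Measure.addHaar_ball_of_pos _ _ (by linarith [hpos x]), hcdef,
        Measure.addHaar_ball_of_pos _ _ (by norm_num : (0:ℝ) < 1 / 8), ← mul_assoc,
        ← ENNReal.ofReal_mul (by have := hpos x; positivity)]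
      have := hpos x
      congr 2
      rw [div_eq_mul_one_div (h x), mul_pow, ← mul_assoc,
        inv_mul_cancel₀ (pow_pos this n).ne', one_mul]
    · rw [indicator_of_notMem hx]
      exact lintegral_eq_zero_of_forall fun z => indicator_of_notMem (fun h => hx h.2.1) _
  have hI : ∫⁻ z, w z = c * σ K := by
    rw [hw]
    rw [← lintegral_lintegral_swap (f := fun x z => p (x, z)) hpm.aemeasurable]
    simp only [hz]
    rw [lintegral_indicator hK, setLIntegral_const]
  have hw2 : ∫⁻ z, w z ^ 2 ≤ c * ∫⁻ x in K, ENNReal.ofReal (h x ^ n)⁻¹ *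
        σ (closedBall x (h x / 2) ∩ K) ∂σ := by
    have s1 : ∫⁻ z, w z ^ 2 = ∫⁻ x, ∫⁻ z, p (x, z) * w z ∂volume ∂σ := by
      rw [lintegral_lintegral_swap (f := fun x z => p (x, z) * w z)
        (hpm.mul (hwm.comp measurable_snd)).aemeasurable]
      congr 1; ext z
      rw [lintegral_mul_const _ (hpr z), sq]
    have s2 : ∀ x, ∫⁻ z, p (x, z) * w z = ∫⁻ x', ∫⁻ z, p (x, z) * p (x', z) ∂volume ∂σ := by
      intro x
      rw [lintegral_lintegral_swap (f := fun x' z => p (x, z) * p (x', z))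
        ((hpm.comp (by fun_prop)).mul hpm).aemeasurable]
      congr 1; ext z
      rw [lintegral_const_mul _ (hpr z)]
    rw [s1, ← lintegral_const_mul' _ _ hct, ← lintegral_indicator hK]
    refine lintegral_mono fun x => ?_
    simp only [s2]
    by_cases hx : x ∈ K
    · rw [indicator_of_mem hx]
      have hle : ∀ x', ∫⁻ z, p (x, z) * p (x', z) ≤
          (closedBall x (h x / 2) ∩ K).indicator
            (fun _ => ENNReal.ofReal (h x ^ n)⁻¹ * c) x' := by
        intro x'
        by_cases hx' : x' ∈ closedBall x (h x / 2) ∩ K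
        · rw [indicator_of_mem hx']
          calc _ ≤ ∫⁻ z, ENNReal.ofReal (h x ^ n)⁻¹ * p (x', z) :=
                lintegral_mono fun z => mul_le_mul_left (indicator_le_self S
                  (fun p => ENNReal.ofReal (h p.1 ^ n)⁻¹) (x, z)) _
            _ = _ := by
              rw [lintegral_const_mul _ (hpl x'), hz,
                indicator_of_mem hx'.2]
        · rw [indicator_of_notMem hx', nonpos_iff_eq_zero]
          refine lintegral_eq_zero_of_forall fun z => ?_
          show p (x, z) * p (x', z) = 0
          by_cases h1 : (x, z) ∈ S
          · by_cases h2 : (x', z) ∈ S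
            · exfalso
              refine hx' ⟨?_, h2.2.1⟩
              have d1 : dist z x < h x / 8 := h1.1
              have d2 : dist z x' < h x' / 8 := h2.1
              have d3 : dist x x' < h x / 8 + h x' / 8 := by
                have := dist_triangle_left x x' z
                linarith
              have := hcomp x hx x' h2.2.1 d3
              rw [mem_closedBall, dist_comm]
              have := hpos x
              linarith
            · rw [hp, indicator_of_notMem h2, mul_zero]
          · rw [hp, indicator_of_notMem h1, zero_mul]
      calc _ ≤ ∫⁻ x', (closedBall x (h x / 2) ∩ K).indicator
            (fun _ => ENNReal.ofReal (h x ^ n)⁻¹ * c) x' ∂σ := lintegral_mono hle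
        _ = _ := by
          rw [lintegral_indicator (measurableSet_closedBall.inter hK), setLIntegral_const]
          ring
    · rw [indicator_of_notMem hx, nonpos_iff_eq_zero]
      have : ∀ x' z, p (x, z) * p (x', z) = 0 := fun x' z => by
        rw [hp, indicator_of_notMem (fun h => hx h.2.1), zero_mul]
      simp [this]
  have hCS := sq_lintegral_le (μ := (volume : Measure E)) hwm (Ω := Ω) (fun z hz => by
    rw [hw]
    simp only
    refine lintegral_eq_zero_of_forall fun x => indicator_of_notMem (fun h => hz ?_) _
    exact hsub x h.2.1 (mem_ball.2 h.1))
  rw [hI] at hCS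
  have h5 : c * (c * σ K ^ 2) ≤ c * (volume Ω * ∫⁻ x in K, ENNReal.ofReal (h x ^ n)⁻¹ *
        σ (closedBall x (h x / 2) ∩ K) ∂σ) := by
    calc c * (c * σ K ^ 2) = (c * σ K) ^ 2 := by ring
      _ ≤ _ := hCS
      _ ≤ volume Ω * (c * ∫⁻ x in K, ENNReal.ofReal (h x ^ n)⁻¹ *
        σ (closedBall x (h x / 2) ∩ K) ∂σ) := mul_le_mul_right hw2 _
      _ = _ := by ring
  exact (ENNReal.mul_le_mul_iff_right hc0 hct).1 h5

theorem abs_integral_sub_translate_le {φ : E → ℝ} (hφ : ContDiff ℝ 1 φ) {t R : ℝ} {x y : E}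
    (hx : x ∈ closedBall 0 R) (hy : y ∈ closedBall 0 R) :
    |∫ z in closedBall 0 t, (φ (x + z) - φ (y + z))| ≤
      (∫ z in closedBall 0 (R + t), ‖fderiv ℝ φ z‖) * ‖x - y‖ := by
  have hd : Continuous (fderiv ℝ φ) := hφ.continuous_fderiv (by simp)
  have hφc := hφ.continuous
  set γ : ℝ → E → E := fun s z => y + z + s • (x - y) with hγ
  have ftc : ∀ z, φ (x + z) - φ (y + z) =
      ∫ s in Ioc (0:ℝ) 1, fderiv ℝ φ (γ s z) (x - y) := by
    intro z
    rw [← intervalIntegral.integral_of_le zero_le_one]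
    rw [intervalIntegral.integral_eq_sub_of_hasDerivAt (f := fun s => φ (γ s z))]
    · simp only [hγ, one_smul, zero_smul, add_zero]
      congr 2; abel
    · intro s _
      have h1 : HasDerivAt (fun s => γ s z) (x - y) s := by
        have := ((hasDerivAt_id s).smul_const (x - y)).const_add (y + z)
        simpa [hγ] using this
      exact ((hφ.differentiable (by simp)) (γ s z)).hasFDerivAt.comp_hasDerivAt s h1
    · exact Continuous.intervalIntegrable (by fun_prop) _ _
  have hint : Integrable (fun p : E × ℝ => fderiv ℝ φ (γ p.2 p.1) (x - y))
      ((volume.restrict (closedBall 0 t)).prod (volume.restrict (Ioc (0:ℝ) 1))) := by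
    rw [Measure.prod_restrict]
    refine IntegrableOn.mono_set (t := closedBall 0 t ×ˢ Icc (0:ℝ) 1) ?_
      (prod_mono_right Ioc_subset_Icc_self)
    exact ContinuousOn.integrableOn_compact ((isCompact_closedBall _ _).prod isCompact_Icc)
      (by fun_prop)
  simp only [ftc]
  rw [integral_integral_swap (f := fun z s => fderiv ℝ φ (γ s z) (x - y)) hint]
  have hb : ∀ s ∈ Ioc (0:ℝ) 1, ‖∫ z in closedBall 0 t, fderiv ℝ φ (γ s z) (x - y)‖ ≤
      (∫ z in closedBall 0 (R + t), ‖fderiv ℝ φ z‖) * ‖x - y‖ := by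
    intro s hs
    set p := y + s • (x - y) with hp
    have hpR : ‖p‖ ≤ R := by
      have := (convex_closedBall (0:E) R) hy hx (sub_nonneg.2 hs.2) hs.1.le (by ring)
      rw [mem_closedBall_zero_iff] at this
      have e : p = (1 - s) • y + s • x := by rw [hp, smul_sub, sub_smul, one_smul]; abel
      rwa [e]
    have e : ∀ z, γ s z = p + z := fun z => by simp only [hγ, hp]; abel
    simp only [e]
    calc _ ≤ ∫ z in closedBall 0 t, ‖fderiv ℝ φ (p + z)‖ * ‖x - y‖ := by
          refine norm_integral_le_of_norm_le ?_ (Eventually.of_forall fun z =>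
            (fderiv ℝ φ (p + z)).le_opNorm _)
          exact ContinuousOn.integrableOn_compact (isCompact_closedBall _ _) (by fun_prop)
      _ = (∫ z in closedBall 0 t, ‖fderiv ℝ φ (p + z)‖) * ‖x - y‖ := integral_mul_const _ _
      _ ≤ _ := by
        refine mul_le_mul_of_nonneg_right ?_ (norm_nonneg _)
        have h2 : ∫ z in closedBall 0 t, ‖fderiv ℝ φ (p + z)‖ =
            ∫ z in closedBall p t, ‖fderiv ℝ φ z‖ := by
          rw [← integral_indicator measurableSet_closedBall,
            ← integral_indicator measurableSet_closedBall,
            ← integral_add_left_eq_self ((closedBall p t).indicator fun z => ‖fderiv ℝ φ z‖) p]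
          congr 1; ext z
          simp [indicator, mem_closedBall, dist_eq_norm]
        rw [h2]
        refine setIntegral_mono_set ?_ (Eventually.of_forall fun z => norm_nonneg _) ?_
        · exact ContinuousOn.integrableOn_compact (isCompact_closedBall _ _) (by fun_prop)
        · exact (closedBall_subset_closedBall' (by rw [dist_zero_right]; linarith)).eventuallyLE
  have := norm_setIntegral_le_of_norm_le_const (μ := (volume : Measure ℝ)) (s := Ioc (0:ℝ) 1)
    (by simp) hb
  simpa using this

/-- A `C^1` function with bounded gradient and small `W^{1,1}` norm has small oscillation. -/
theorem abs_sub_le_of_fderiv {φ : E → ℝ} (hφ : ContDiff ℝ 1 φ) {L S t R : ℝ} (ht : 0 < t)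
    (hL : ∀ z ∈ closedBall (0 : E) (R + t), ‖fderiv ℝ φ z‖ ≤ L)
    (hS : ∫ z in closedBall (0 : E) (R + t), ‖fderiv ℝ φ z‖ ≤ S)
    {x y : E} (hx : x ∈ closedBall 0 R) (hy : y ∈ closedBall 0 R) :
    |φ x - φ y| ≤ 2 * L * t + S * (2 * R) / volume.real (closedBall (0 : E) t) := by
  have hφc := hφ.continuous
  set V := volume.real (closedBall (0 : E) t) with hV
  have hV0 : 0 < V := ENNReal.toReal_pos (measure_closedBall_pos _ _ ht).ne'
    measure_closedBall_lt_top.ne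
  have hci : ∀ f : E → ℝ, Continuous f → IntegrableOn f (closedBall 0 t) := fun f hf =>
    hf.continuousOn.integrableOn_compact (isCompact_closedBall _ _)
  have near : ∀ x ∈ closedBall (0 : E) R, |∫ z in closedBall 0 t, (φ x - φ (x + z))| ≤
      L * t * V := by
    intro x hx
    rw [← Real.norm_eq_abs]
    refine norm_setIntegral_le_of_norm_le_const (C := L * t) measure_closedBall_lt_top
      fun z hz => ?_
    have hz' : ‖z‖ ≤ t := by simpa using hz
    have hx' : ‖x‖ ≤ R := by simpa using hx
    have hmv := (convex_closedBall (0:E) (R + t)).norm_image_sub_le_of_norm_fderiv_le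
      (f := φ) (𝕜 := ℝ) (fun z _ => (hφ.differentiable (by simp)) z) hL
      (x := x + z) (y := x) (by
        rw [mem_closedBall_zero_iff]; exact (norm_add_le _ _).trans (add_le_add hx' hz'))
      (by rw [mem_closedBall_zero_iff]; linarith)
    refine hmv.trans ?_
    rw [sub_add_cancel_left, norm_neg]
    refine mul_le_mul_of_nonneg_left hz' ((norm_nonneg _).trans (hL x ?_))
    rw [mem_closedBall_zero_iff]; linarith
  have hmid := abs_integral_sub_translate_le hφ hx hy (t := t)
  have hS0 : 0 ≤ ∫ z in closedBall (0 : E) (R + t), ‖fderiv ℝ φ z‖ :=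
    integral_nonneg fun _ => norm_nonneg _
  have hxy : ‖x - y‖ ≤ 2 * R := by
    rw [mem_closedBall_zero_iff] at hx hy
    exact (norm_sub_le _ _).trans (by linarith)
  have hmid' := hmid.trans (mul_le_mul hS hxy (norm_nonneg _) (hS0.trans hS))
  have htot : V * (φ x - φ y) = (∫ z in closedBall 0 t, (φ x - φ (x + z))) +
      (∫ z in closedBall 0 t, (φ (x + z) - φ (y + z))) -
      ∫ z in closedBall 0 t, (φ y - φ (y + z)) := by
    rw [← integral_add, ← integral_sub, hV, ← smul_eq_mul, ← setIntegral_const]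
    · congr 1; ext z; ring
    all_goals exact hci _ (by fun_prop)
  have h1 := abs_le.1 (near x hx)
  have h2 := abs_le.1 (near y hy)
  have h3 := abs_le.1 hmid'
  have h4 : |V * (φ x - φ y)| ≤ 2 * L * t * V + S * (2 * R) := by
    rw [htot, abs_le]
    constructor <;> linarith [h1.1, h1.2, h2.1, h2.2, h3.1, h3.2]
  rw [abs_mul, abs_of_pos hV0] at h4
  have h5 : 2 * L * t + S * (2 * R) / V = (2 * L * t * V + S * (2 * R)) / V := by
    field_simp
  rw [h5, le_div_iff₀ hV0, mul_comm]
  exact h4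

/-- The points at which `σ` has density at most `Λ` at all scales in `[ρ, 1]`. -/
def goodSet (σ : Measure E) (ρ Λ : ℝ) : Set E :=
  {x | ∀ r ∈ Icc ρ 1, σ (ball x r) ≤ ENNReal.ofReal (Λ * r ^ Module.finrank ℝ E)}

theorem isOpen_setOf_lt_measure_ball (σ : Measure E) (r : ℝ) (a : ℝ≥0∞) :
    IsOpen {x | a < σ (ball x r)} := by
  rw [Metric.isOpen_iff]
  intro x hx
  have hU : ball x r = ⋃ k : ℕ, ball x (r - 1 / ((k : ℝ) + 1)) := by
    ext y
    simp only [mem_ball, mem_iUnion]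
    constructor
    · intro hy
      obtain ⟨k, hk⟩ := exists_nat_one_div_lt (sub_pos.2 hy)
      exact ⟨k, by linarith⟩
    · rintro ⟨k, hk⟩
      have : 0 < 1 / ((k : ℝ) + 1) := Nat.one_div_pos_of_nat
      linarith
  have hmono : Monotone fun k : ℕ => ball x (r - 1 / ((k : ℝ) + 1)) := fun i j hij =>
    ball_subset_ball (sub_le_sub_left (Nat.one_div_le_one_div hij) _)
  rw [mem_ofPred_eq, hU, hmono.measure_iUnion, lt_iSup_iff] at hx
  obtain ⟨k, hk⟩ := hx
  refine ⟨1 / ((k : ℝ) + 1), Nat.one_div_pos_of_nat, fun y hy => hk.trans_le ?_⟩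
  refine measure_mono (ball_subset_ball' ?_)
  rw [dist_comm]
  have := mem_ball.1 hy
  linarith

theorem isClosed_goodSet (σ : Measure E) (ρ Λ : ℝ) : IsClosed (goodSet σ ρ Λ) := by
  have : goodSet σ ρ Λ = ⋂ r ∈ Icc ρ 1,
      {x | ENNReal.ofReal (Λ * r ^ Module.finrank ℝ E) < σ (ball x r)}ᶜ := by
    ext x; simp [goodSet]
  rw [this]
  exact isClosed_biInter fun r _ => (isOpen_setOf_lt_measure_ball σ r _).isClosed_compl

theorem volume_iUnion_goodSet_compl_le (σ : Measure E) {ρ Λ : ℝ} (hρ : 0 < ρ) (hΛ : 0 < Λ)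
    (R : ℝ) :
    volume (⋃ x ∈ (goodSet σ ρ Λ)ᶜ ∩ closedBall 0 R, closedBall x ρ) ≤
      ENNReal.ofReal (5 ^ Module.finrank ℝ E / Λ) * volume (ball (0 : E) 1) *
        σ (closedBall 0 (R + 1)) := by
  set n := Module.finrank ℝ E with hn
  have hr : ∀ x, ∃ r, x ∈ (goodSet σ ρ Λ)ᶜ ∩ closedBall 0 R →
      ρ ≤ r ∧ r ≤ 1 ∧ ENNReal.ofReal (Λ * r ^ n) < σ (ball x r) := by
    intro x
    by_cases hx : x ∈ (goodSet σ ρ Λ)ᶜ ∩ closedBall 0 R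
    · have h1 := hx.1
      simp only [goodSet, mem_compl_iff, mem_ofPred_eq, not_forall, not_le] at h1
      obtain ⟨r, hr, h⟩ := h1
      exact ⟨r, fun _ => ⟨hr.1, hr.2, h⟩⟩
    · exact ⟨0, fun h => absurd h hx⟩
  choose r hr using hr
  obtain ⟨u, hut, hud, hu⟩ := Vitali.exists_disjoint_subfamily_covering_enlargement_closedBall
    ((goodSet σ ρ Λ)ᶜ ∩ closedBall 0 R) (fun x => x) r 1 (fun a ha => (hr a ha).2.1) 5 (by norm_num)
  have hupos : ∀ b ∈ u, 0 < r b := fun b hb => hρ.trans_le (hr b (hut hb)).1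
  have huc : u.Countable := hud.countable_of_nonempty_interior fun b hb =>
    ⟨b, ball_subset_interior_closedBall (mem_ball_self (hupos b hb))⟩
  have hsub : (⋃ x ∈ (goodSet σ ρ Λ)ᶜ ∩ closedBall 0 R, closedBall x ρ) ⊆
      ⋃ b ∈ u, closedBall b (5 * r b) := by
    refine iUnion₂_subset fun x hx => ?_
    obtain ⟨b, hb, hxb⟩ := hu x hx
    exact ((closedBall_subset_closedBall (hr x hx).1).trans hxb).trans
      (subset_biUnion_of_mem (u := fun b => closedBall b (5 * r b)) hb)
  have hball : ∀ b ∈ u, volume (closedBall b (5 * r b)) ≤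
      ENNReal.ofReal (5 ^ n / Λ) * volume (ball (0 : E) 1) * σ (closedBall b (r b)) := by
    intro b hb
    rw [Measure.addHaar_closedBall _ _ (by linarith [hupos b hb])]
    have h1 := (hr b (hut hb)).2.2.le.trans (measure_mono ball_subset_closedBall)
    calc ENNReal.ofReal ((5 * r b) ^ n) * volume (ball (0 : E) 1)
        = ENNReal.ofReal (5 ^ n / Λ) * volume (ball (0 : E) 1) * ENNReal.ofReal (Λ * r b ^ n) := by
          rw [mul_right_comm, ← ENNReal.ofReal_mul (by positivity), mul_pow]
          congr 2
          field_simp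
      _ ≤ _ := mul_le_mul_right h1 _
  have : Countable u := huc.to_subtype
  calc _ ≤ volume (⋃ b ∈ u, closedBall b (5 * r b)) := measure_mono hsub
    _ ≤ ∑' b : u, volume (closedBall (b : E) (5 * r b)) := measure_biUnion_le _ huc _
    _ ≤ ∑' b : u, ENNReal.ofReal (5 ^ n / Λ) * volume (ball (0 : E) 1) *
          σ (closedBall (b : E) (r b)) := ENNReal.tsum_le_tsum fun b => hball b b.2
    _ = ENNReal.ofReal (5 ^ n / Λ) * volume (ball (0 : E) 1) *
          ∑' b : u, σ (closedBall (b : E) (r b)) := ENNReal.tsum_mul_left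
    _ = ENNReal.ofReal (5 ^ n / Λ) * volume (ball (0 : E) 1) *
          σ (⋃ b ∈ u, closedBall b (r b)) := by
        rw [measure_biUnion huc hud fun b _ => measurableSet_closedBall]
    _ ≤ _ := by
        refine mul_le_mul_right (measure_mono (iUnion₂_subset fun b hb => ?_)) _
        refine closedBall_subset_closedBall' ?_
        have h1 := mem_closedBall.1 (hut hb).2
        have h2 := (hr b (hut hb)).2.1
        linarith

theorem measure_inter_goodSet_le (σ : Measure E) [SFinite σ] {ρ Λ : ℝ} (hρ : 0 < ρ) (hρ1 : ρ ≤ 1)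
    {K : Set E} (hK : MeasurableSet K) :
    σ (K ∩ goodSet σ ρ Λ) * volume (ball (0 : E) (ρ / 3)) ≤
      ENNReal.ofReal (Λ * ρ ^ Module.finrank ℝ E) * volume (cthickening ρ K) := by
  set G := goodSet σ ρ Λ with hG
  have hGm : MeasurableSet (K ∩ G) := hK.inter (isClosed_goodSet σ ρ Λ).measurableSet
  set A : Set (E × E) := {p | dist p.1 p.2 < ρ / 3} ∩ (K ∩ G) ×ˢ univ with hA
  have hAm : MeasurableSet A :=
    (isOpen_lt (by fun_prop) continuous_const).measurableSet.inter (hGm.prod MeasurableSet.univ)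
  have e1 : (σ.prod volume) A = σ (K ∩ G) * volume (ball (0 : E) (ρ / 3)) := by
    rw [Measure.prod_apply hAm, mul_comm, ← setLIntegral_const, ← lintegral_indicator hGm]
    congr 1; ext x
    by_cases hx : x ∈ K ∩ G
    · rw [indicator_of_mem hx, ← Measure.addHaar_ball_center volume x]
      congr 1; ext y
      simp [hA, hx.1, hx.2, dist_comm]
    · rw [indicator_of_notMem hx, ← measure_empty (μ := (volume : Measure E))]
      congr 1; ext y
      simp only [hA, mem_preimage, mem_inter_iff, mem_prod, mem_empty_iff_false, iff_false]
      exact fun h => hx ⟨h.2.1.1, h.2.1.2⟩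
  rw [← e1, Measure.prod_apply_symm hAm, ← setLIntegral_const,
    ← lintegral_indicator isClosed_cthickening.measurableSet]
  refine lintegral_mono fun y => ?_
  rcases ((fun x => (x, y)) ⁻¹' A).eq_empty_or_nonempty with h | ⟨x, hx⟩
  · simp [h]
  · have hxy : dist x y < ρ / 3 := hx.1
    have hxK : x ∈ K ∩ G := hx.2.1
    rw [indicator_of_mem]
    · refine (measure_mono (t := ball x ρ) fun z hz => ?_).trans (hxK.2 ρ ⟨le_rfl, hρ1⟩)
      have hzy : dist z y < ρ / 3 := hz.1
      have := dist_triangle_right z x y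
      rw [mem_ball]; linarith
    · exact mem_cthickening_of_dist_le y x ρ K hxK.1 (by rw [dist_comm]; linarith)

/-- A smooth substitute for the distance function to a set. -/
theorem exists_smooth_infDist (G : Set E) {ρ κ : ℝ} (hρ : 0 < ρ) (hκ : 0 < κ) :
    ∃ h : E → ℝ, ContDiff ℝ 1 h ∧ (∀ x, ‖fderiv ℝ h x‖ ≤ κ) ∧
      (∀ x, κ * (infDist x G + ρ) ≤ h x) ∧ ∀ x, h x ≤ κ * (infDist x G + 3 * ρ) := by
  let f : ContDiffBump (0 : E) := ⟨ρ / 2, ρ, by positivity, by linarith⟩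
  set D : E → ℝ := fun x => infDist x G with hD
  have hDc : Continuous D := continuous_infDist_pt G
  set g : E → ℝ := fun x => ∫ t, f.normed volume t * D (x - t) with hg
  have hgc : g = MeasureTheory.convolution (f.normed volume) D (ContinuousLinearMap.lsmul ℝ ℝ)
      volume := by
    ext x; rfl
  have hgs : ContDiff ℝ 1 g := by
    rw [hgc]
    exact f.hasCompactSupport_normed.contDiff_convolution_left _ f.contDiff_normed
      hDc.locallyIntegrable
  have hint : ∀ x, Integrable (fun t => f.normed volume t * D (x - t)) volume := fun x =>
    Continuous.integrable_of_hasCompactSupport (f.continuous_normed.mul (by fun_prop))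
      f.hasCompactSupport_normed.mul_right
  have hlip : LipschitzWith 1 g := by
    refine LipschitzWith.of_dist_le_mul fun x y => ?_
    rw [NNReal.coe_one, one_mul, dist_eq_norm, hg]
    simp only
    rw [← integral_sub (hint x) (hint y)]
    calc _ ≤ ∫ t, f.normed volume t * dist x y := by
          refine norm_integral_le_of_norm_le (f.integrable_normed.mul_const _)
            (Eventually.of_forall fun t => ?_)
          rw [← mul_sub, norm_mul, Real.norm_of_nonneg (f.nonneg_normed _)]
          refine mul_le_mul_of_nonneg_left ?_ (f.nonneg_normed _)
          have := (lipschitz_infDist_pt G).dist_le_mul (x - t) (y - t)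
          rwa [NNReal.coe_one, one_mul, dist_sub_right] at this
      _ = dist x y := by rw [integral_mul_const, f.integral_normed, one_mul]
  have hclose : ∀ x, dist (g x) (D x) ≤ ρ := by
    intro x
    rw [hgc]
    refine ContDiffBump.dist_normed_convolution_le hDc.aestronglyMeasurable fun y hy => ?_
    have := (lipschitz_infDist_pt G).dist_le_mul y x
    rw [NNReal.coe_one, one_mul] at this
    exact this.trans (mem_ball.1 hy).le
  refine ⟨fun x => κ * (g x + 2 * ρ), contDiff_const.mul (hgs.add contDiff_const), ?_, ?_, ?_⟩
  · intro x
    have h1 : HasFDerivAt (fun x => κ * (g x + 2 * ρ)) (κ • fderiv ℝ g x) x :=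
      (((hgs.differentiable (by simp)) x).hasFDerivAt.add_const _).const_mul κ
    rw [h1.fderiv, norm_smul, Real.norm_of_nonneg hκ.le]
    have := norm_fderiv_le_of_lipschitz ℝ hlip (x₀ := x)
    rw [NNReal.coe_one] at this
    nlinarith
  · intro x
    have := abs_le.1 (hclose x)
    refine mul_le_mul_of_nonneg_left ?_ hκ.le
    linarith [this.1]
  · intro x
    have := abs_le.1 (hclose x)
    refine mul_le_mul_of_nonneg_left ?_ hκ.le
    linarith [this.2]

theorem exists_scale_measure_inter_goodSet_le (σ : Measure E) [SFinite σ] {Λ : ℝ} (hΛ : 0 < Λ)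
    {K : Set E} (hK : IsCompact K) (hK0 : volume K = 0) {δ : ℝ≥0∞} (hδ : δ ≠ 0) :
    ∃ ρ, 0 < ρ ∧ ρ ≤ 1 / 16 ∧ σ (K ∩ goodSet σ ρ Λ) ≤ δ := by
  set n := Module.finrank ℝ E with hn
  set ω := volume (ball (0 : E) (1 / 3)) with hω
  have hω0 : ω ≠ 0 := (measure_ball_pos _ _ (by norm_num)).ne'
  have hωt : ω ≠ ∞ := measure_ball_lt_top.ne
  have hlim : Tendsto (fun ρ => ENNReal.ofReal Λ * volume (cthickening ρ K)) (𝓝 0) (𝓝 0) := by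
    have := tendsto_measure_cthickening_of_isCompact (μ := (volume : Measure E)) hK
    rw [hK0] at this
    simpa using ENNReal.Tendsto.const_mul this (Or.inr ENNReal.ofReal_ne_top)
  have hev : ∀ᶠ ρ in 𝓝[>] (0:ℝ), ENNReal.ofReal Λ * volume (cthickening ρ K) < δ * ω :=
    (hlim.mono_left nhdsWithin_le_nhds).eventually (gt_mem_nhds (by
      exact pos_iff_ne_zero.2 (mul_ne_zero hδ hω0)))
  have hev2 : ∀ᶠ ρ in 𝓝[>] (0:ℝ), ρ ∈ Ioc (0:ℝ) (1 / 16) := Ioc_mem_nhdsGT (by norm_num)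
  obtain ⟨ρ, h1, h2⟩ := (hev.and hev2).exists
  refine ⟨ρ, h2.1, h2.2, ?_⟩
  have h3 := measure_inter_goodSet_le σ (Λ := Λ) h2.1 (h2.2.trans (by norm_num)) hK.measurableSet
  have e : volume (ball (0 : E) (ρ / 3)) = ENNReal.ofReal (ρ ^ n) * ω := by
    rw [hω, Measure.addHaar_ball_of_pos _ _ (by linarith [h2.1]),
      Measure.addHaar_ball_of_pos _ _ (by norm_num : (0:ℝ) < 1 / 3), ← mul_assoc,
      ← ENNReal.ofReal_mul (by have := h2.1; positivity), ← mul_pow, mul_one_div]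
  have hρn : 0 < ρ ^ n := pow_pos h2.1 n
  have h4 : ENNReal.ofReal (ρ ^ n) * (σ (K ∩ goodSet σ ρ Λ) * ω) ≤
      ENNReal.ofReal (ρ ^ n) * (δ * ω) := by
    calc _ = σ (K ∩ goodSet σ ρ Λ) * volume (ball (0 : E) (ρ / 3)) := by rw [e]; ring
      _ ≤ _ := h3
      _ = ENNReal.ofReal (ρ ^ n) * (ENNReal.ofReal Λ * volume (cthickening ρ K)) := by
        rw [ENNReal.ofReal_mul hΛ.le]; ring
      _ ≤ _ := mul_le_mul_right h1.le _
  rw [ENNReal.mul_le_mul_iff_right (ENNReal.ofReal_pos.2 hρn).ne' ENNReal.ofReal_ne_top] at h4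
  exact (ENNReal.mul_le_mul_iff_left hω0 hωt).1 h4

theorem exists_mem_goodSet_dist_lt {σ : Measure E} {C₀ Λ ρ : ℝ}
    (hσ : σ (closedBall 0 5) ≤ ENNReal.ofReal C₀) (hC₀ : 0 < C₀)
    (hΛ : 20 ^ Module.finrank ℝ E * C₀ < Λ) (hρ : 0 < ρ) {x : E} (hx : x ∈ closedBall 0 3) :
    ∃ y ∈ goodSet σ ρ Λ, dist x y < 1 / 4 := by
  set n := Module.finrank ℝ E with hn
  by_contra! hcon
  have hΛ0 : 0 < Λ := lt_trans (by positivity) hΛ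
  have h1 := volume_iUnion_goodSet_compl_le σ hρ hΛ0 4
  have h2 : ball x (1 / 4) ⊆ ⋃ x ∈ (goodSet σ ρ Λ)ᶜ ∩ closedBall 0 4, closedBall x ρ := by
    intro y hy
    rw [mem_ball] at hy
    refine mem_biUnion (x := y) ⟨fun hyG => ?_, ?_⟩ (mem_closedBall_self hρ.le)
    · have := hcon y hyG
      rw [dist_comm] at this
      linarith
    · rw [mem_closedBall] at hx ⊢
      have := dist_triangle y x 0
      linarith
  have h3 := (measure_mono (μ := (volume : Measure E)) h2).trans h1
  have hω0 : volume (ball (0 : E) 1) ≠ 0 := (measure_ball_pos _ _ one_pos).ne'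
  have hωt : volume (ball (0 : E) 1) ≠ ∞ := measure_ball_lt_top.ne
  rw [Measure.addHaar_ball_of_pos _ _ (by norm_num : (0:ℝ) < 1 / 4), mul_right_comm,
    ENNReal.mul_le_mul_iff_left hω0 hωt] at h3
  have h4 : ENNReal.ofReal ((1 / 4) ^ n) ≤ ENNReal.ofReal (5 ^ n / Λ * C₀) := by
    rw [ENNReal.ofReal_mul (by positivity)]
    refine h3.trans (mul_le_mul_right ?_ _)
    rwa [show (4:ℝ) + 1 = 5 by norm_num]
  rw [ENNReal.ofReal_le_ofReal_iff (by positivity), div_mul_eq_mul_div, le_div_iff₀ hΛ0] at h4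
  have h5 : (20:ℝ) ^ n = 4 ^ n * 5 ^ n := by rw [← mul_pow]; norm_num
  have h6 : (4:ℝ) ^ n * (1 / 4) ^ n = 1 := by rw [← mul_pow]; norm_num
  have h7 : (0:ℝ) < 4 ^ n := by positivity
  have h8 := mul_le_mul_of_nonneg_left h4 h7.le
  rw [← mul_assoc, h6, one_mul] at h8
  rw [h5] at hΛ
  linarith

/-- Choice of the variable mollification radius. -/
theorem exists_radius {σ : Measure E} {C₀ Λ ρ κ : ℝ}
    (hσ : σ (closedBall 0 5) ≤ ENNReal.ofReal C₀) (hC₀ : 0 < C₀)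
    (hΛ : 20 ^ Module.finrank ℝ E * C₀ < Λ) (hρ : 0 < ρ) (hρ1 : ρ ≤ 1 / 16) (hκ : 0 < κ)
    (hκ1 : κ ≤ 1 / 32) :
    ∃ h : E → ℝ, ContDiff ℝ 1 h ∧ (∀ x, ‖fderiv ℝ h x‖ ≤ κ) ∧ (∀ x, κ * ρ ≤ h x) ∧
      (∀ x ∈ closedBall 0 3, h x ≤ 1 / 64) ∧
      (∀ x ∈ closedBall 0 3, σ (closedBall x (4 * h x)) ≤
        ENNReal.ofReal (Λ * (2 / κ) ^ Module.finrank ℝ E * h x ^ Module.finrank ℝ E)) ∧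
      ∀ x ∈ (goodSet σ ρ Λ)ᶜ ∩ closedBall 0 1, ball x (h x / 8) ⊆
        ⋃ x ∈ (goodSet σ ρ Λ)ᶜ ∩ closedBall 0 4, closedBall x ρ := by
  set n := Module.finrank ℝ E with hn
  set G := goodSet σ ρ Λ with hG
  have hΛ0 : 0 < Λ := lt_trans (by positivity) hΛ
  obtain ⟨h, hh, hd, hlo, hup⟩ := exists_smooth_infDist G hρ hκ
  have hD0 : ∀ x, 0 ≤ infDist x G := fun x => infDist_nonneg
  have hD : ∀ x ∈ closedBall (0:E) 3, infDist x G ≤ 1 / 4 := by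
    intro x hx
    obtain ⟨y, hy, hxy⟩ := exists_mem_goodSet_dist_lt hσ hC₀ hΛ hρ hx
    exact (infDist_le_dist_of_mem hy).trans hxy.le
  have hGne : G.Nonempty := by
    obtain ⟨y, hy, -⟩ := exists_mem_goodSet_dist_lt (x := (0:E)) hσ hC₀ hΛ hρ (by simp)
    exact ⟨y, hy⟩
  refine ⟨h, hh, hd, fun x => ?_, fun x hx => ?_, fun x hx => ?_, fun x hx => ?_⟩
  · have := hlo x; nlinarith [hD0 x]
  · have h1 := hup x
    have h2 := hD x hx
    nlinarith
  · obtain ⟨y, hy, hxy⟩ := (infDist_lt_iff (x := x) hGne (r := infDist x G + ρ)).1 (by linarith)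
    have h1 := hup x
    have h2 := hD x hx
    have h3 := hD0 x
    have h4 : 4 * h x ≤ infDist x G + ρ := by nlinarith
    have h5 := hlo x
    refine (measure_mono (t := ball y (2 * (infDist x G + ρ))) ?_).trans ((hy _ ⟨?_, ?_⟩).trans ?_)
    · intro z hz
      rw [mem_closedBall] at hz
      rw [mem_ball]
      have := dist_triangle z x y
      linarith
    · linarith
    · linarith
    · refine ENNReal.ofReal_le_ofReal ?_
      rw [mul_assoc, ← mul_pow]
      refine mul_le_mul_of_nonneg_left (pow_le_pow_left₀ (by linarith) ?_ n) hΛ0.le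
      rw [div_mul_eq_mul_div, le_div_iff₀ hκ]
      linarith
  · intro y hy
    rw [mem_ball] at hy
    have h1 := hup x
    have hx1 := mem_closedBall.1 hx.2
    by_cases hDx : 3 * ρ ≤ infDist x G
    · refine mem_biUnion (x := y) ⟨fun hyG => ?_, ?_⟩ (mem_closedBall_self hρ.le)
      · have h2 := infDist_le_dist_of_mem hyG (x := x)
        rw [dist_comm] at h2
        nlinarith
      · have h2 := hD x (closedBall_subset_closedBall (by norm_num) hx.2)
        rw [mem_closedBall]
        have := dist_triangle y x 0
        nlinarith
    · refine mem_biUnion (x := x) ⟨hx.1, closedBall_subset_closedBall (by norm_num) hx.2⟩ ?_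
      rw [mem_closedBall]
      nlinarith [hD0 x]

theorem abs_sub_le_of_norm_fderiv_le {h : E → ℝ} (hh : ContDiff ℝ 1 h) {κ : ℝ}
    (hκ : ∀ x, ‖fderiv ℝ h x‖ ≤ κ) (x y : E) : |h x - h y| ≤ κ * dist x y := by
  rw [dist_eq_norm]
  exact convex_univ.norm_image_sub_le_of_norm_fderiv_le (𝕜 := ℝ)
    (fun z _ => (hh.differentiable (by simp)) z) (fun z _ => hκ z) (mem_univ y) (mem_univ x)

section

variable {σ : Measure E} [IsFiniteMeasure σ]

theorem stronglyMeasurable_setIntegral_closedBall {r : E → ℝ} (hr : Continuous r) {g : E → ℝ}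
    (hg : StronglyMeasurable g) :
    StronglyMeasurable fun x => ∫ y in closedBall x (r x), g y ∂σ := by
  have hSm : MeasurableSet {p : E × E | dist p.2 p.1 ≤ r p.1} :=
    (isClosed_le (by fun_prop) (by fun_prop)).measurableSet
  have h1 : StronglyMeasurable ({p : E × E | dist p.2 p.1 ≤ r p.1}.indicator fun p => g p.2) :=
    (hg.comp_measurable measurable_snd).indicator hSm
  have h2 := h1.integral_prod_right' (ν := σ)
  convert h2 using 2 with x
  rw [← integral_indicator measurableSet_closedBall]
  rfl

theorem integrable_averaged {h : E → ℝ} (hc : Continuous h) {h₀ : ℝ} (h₀pos : 0 < h₀)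
    (hh₀ : ∀ x, h₀ ≤ h x) {r : E → ℝ} (hr : Continuous r) {g : E → ℝ} (hg : StronglyMeasurable g)
    {A : ℝ} (hA : ∀ x, ‖g x‖ ≤ A) (M : ℝ) (n : ℕ) :
    Integrable (fun x => M * (h x ^ n)⁻¹ * ∫ y in closedBall x (r x), g y ∂σ) σ := by
  refine Integrable.of_bound (C := |M| * (h₀ ^ n)⁻¹ * (A * σ.real univ)) ?_
    (Eventually.of_forall fun x => ?_)
  · exact ((stronglyMeasurable_const.mul (hc.stronglyMeasurable.pow n).inv₀).mul
      (stronglyMeasurable_setIntegral_closedBall hr hg)).aestronglyMeasurable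
  · have hA0 : 0 ≤ A := (norm_nonneg _).trans (hA 0)
    rw [norm_mul, norm_mul, Real.norm_eq_abs M, Real.norm_of_nonneg
      (inv_nonneg.2 (pow_nonneg (h₀pos.le.trans (hh₀ x)) n))]
    refine mul_le_mul ?_ ?_ (norm_nonneg _) (by positivity)
    · refine mul_le_mul_of_nonneg_left ?_ (abs_nonneg _)
      exact inv_anti₀ (pow_pos h₀pos n) (pow_le_pow_left₀ h₀pos.le (hh₀ x) n)
    · refine (norm_setIntegral_le_of_norm_le_const (C := A) (measure_lt_top _ _)
        fun y _ => hA y).trans ?_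
      exact mul_le_mul_of_nonneg_left (measureReal_mono (subset_univ _)) hA0

end

section

variable {σ : Measure E} [IsFiniteMeasure σ] {β : E → E}

/-- Comparability of the radii `h x` and `h y` for nearby points. -/
theorem radius_comparable {h : E → ℝ} {κ : ℝ} (hκ1 : κ ≤ 1 / 32)
    (hlip : ∀ x y, |h x - h y| ≤ κ * dist x y) (hpos : ∀ x, 0 < h x) {x y : E}
    (hxy : dist y x ≤ 2 * h x) : h y ≤ 2 * h x ∧ dist x y ≤ 4 * h y := by
  have h1 := abs_le.1 (hlip x y)
  have h2 := hpos x
  have h3 := dist_nonneg (x := x) (y := y)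
  rw [dist_comm] at hxy
  constructor <;> nlinarith [h1.1, h1.2]

theorem integral_norm_le_of_averaged {τ : Measure E} [IsFiniteMeasureOnCompacts τ] [SFinite τ]
    {h : E → ℝ} (hc : Continuous h)
    (hpos : ∀ x, 0 < h x) {B B' : Set E} (hB : MeasurableSet B) (hB' : MeasurableSet B')
    (hcomp : ∀ x ∈ B, ∀ y, dist y x ≤ 2 * h x → y ∈ B' ∧ h y ≤ 2 * h x ∧ dist x y ≤ 4 * h y)
    {Θ : ℝ} (hΘ : ∀ y ∈ B',
      τ (closedBall y (4 * h y)) ≤ ENNReal.ofReal (Θ * h y ^ Module.finrank ℝ E)) (hΘ0 : 0 ≤ Θ)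
    {g : E → ℝ} (hg : StronglyMeasurable g) (hg0 : ∀ y, 0 ≤ g y) (hgi : Integrable g σ)
    {M : ℝ} (hM : 0 ≤ M) {f : E → ℝ} (hf : AEStronglyMeasurable f (τ.restrict B))
    (hf0 : ∀ x, 0 ≤ f x)
    (hfle : ∀ x, f x ≤ M * (h x ^ Module.finrank ℝ E)⁻¹ * ∫ y in closedBall x (2 * h x), g y ∂σ) :
    ∫ x in B, f x ∂τ ≤ M * (2 ^ Module.finrank ℝ E * Θ) * ∫ y in B', g y ∂σ := by
  set n := Module.finrank ℝ E with hn
  have h1 := lintegral_averaged_le (σ := σ) hc hpos hB hB' hcomp hΘ hg.measurable.ennreal_ofReal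
  have hint : ∀ s, ENNReal.ofReal (∫ y in s, g y ∂σ) = ∫⁻ y in s, ENNReal.ofReal (g y) ∂σ :=
    fun s => ofReal_integral_eq_lintegral_ofReal hgi.restrict (Eventually.of_forall hg0)
  have hI0 : 0 ≤ ∫ y in B', g y ∂σ := integral_nonneg hg0
  rw [integral_eq_lintegral_of_nonneg_ae (Eventually.of_forall hf0) hf]
  refine ENNReal.toReal_le_of_le_ofReal (by positivity) ?_
  calc ∫⁻ x in B, ENNReal.ofReal (f x) ∂τ
      ≤ ∫⁻ x in B, ENNReal.ofReal M * (ENNReal.ofReal (h x ^ n)⁻¹ *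
          ∫⁻ y in closedBall x (2 * h x), ENNReal.ofReal (g y) ∂σ) ∂τ := by
        refine lintegral_mono fun x => ?_
        rw [← hint, ← mul_assoc, ← ENNReal.ofReal_mul hM, ← ENNReal.ofReal_mul
          (mul_nonneg hM (inv_nonneg.2 (pow_nonneg (hpos x).le n)))]
        exact ENNReal.ofReal_le_ofReal (hfle x)
    _ = ENNReal.ofReal M * ∫⁻ x in B, (ENNReal.ofReal (h x ^ n)⁻¹ *
          ∫⁻ y in closedBall x (2 * h x), ENNReal.ofReal (g y) ∂σ) ∂τ :=
        lintegral_const_mul' _ _ ENNReal.ofReal_ne_top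
    _ ≤ ENNReal.ofReal M * (ENNReal.ofReal (2 ^ n * Θ) *
          ∫⁻ y in B', ENNReal.ofReal (g y) ∂σ) := mul_le_mul_right h1 _
    _ = _ := by
      rw [← hint, ← mul_assoc, ← ENNReal.ofReal_mul hM, ← ENNReal.ofReal_mul (by positivity)]

theorem le_setIntegral_energy {h : E → ℝ} (hc : Continuous h) {h₀ : ℝ} (h₀pos : 0 < h₀)
    (hh₀ : ∀ x, h₀ ≤ h x) {K Ω : Set E} (hK : MeasurableSet K)
    (hsub : ∀ x ∈ K, ball x (h x / 8) ⊆ Ω)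
    (hcomp : ∀ x ∈ K, ∀ y ∈ K, dist x y < h x / 8 + h y / 8 → h y ≤ 2 * h x)
    {C₀ Λ s : ℝ} (hC₀ : 0 < C₀) (hΛ : 0 < Λ) (hs : 0 ≤ s) (hsK : ENNReal.ofReal s ≤ σ K)
    (hΩ : volume Ω ≤ ENNReal.ofReal (5 ^ Module.finrank ℝ E / Λ) * volume (ball (0 : E) 1) *
      ENNReal.ofReal C₀) :
    s ^ 2 * Λ / (40 ^ Module.finrank ℝ E * C₀) ≤
      ∫ x in K, (h x ^ Module.finrank ℝ E)⁻¹ * σ.real (closedBall x (h x / 2)) ∂σ := by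
  set n := Module.finrank ℝ E with hn
  have hpos : ∀ x, 0 < h x := fun x => h₀pos.trans_le (hh₀ x)
  have hE := energy_lower_bound (σ := σ) hc hpos hK hsub hcomp
  set J := ∫ x in K, (h x ^ n)⁻¹ * σ.real (closedBall x (h x / 2)) ∂σ with hJ
  have hint : Integrable (fun x => (h x ^ n)⁻¹ * σ.real (closedBall x (h x / 2))) σ := by
    have := integrable_averaged (σ := σ) hc h₀pos hh₀ (r := fun x => h x / 2) (by fun_prop)
      (g := fun _ => 1) stronglyMeasurable_const (A := 1) (fun _ => by simp) 1 n
    simpa using this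
  have hJ1 : ∫⁻ x in K, ENNReal.ofReal (h x ^ n)⁻¹ * σ (closedBall x (h x / 2) ∩ K) ∂σ ≤
      ENNReal.ofReal J := by
    rw [hJ, ofReal_integral_eq_lintegral_ofReal hint.restrict (Eventually.of_forall fun x =>
      mul_nonneg (inv_nonneg.2 (pow_nonneg (hpos x).le n)) measureReal_nonneg)]
    refine lintegral_mono fun x => ?_
    rw [ENNReal.ofReal_mul (inv_nonneg.2 (pow_nonneg (hpos x).le n)), ofReal_measureReal]
    exact mul_le_mul_right (measure_mono inter_subset_left) _
  have hJ0 : 0 ≤ J := integral_nonneg fun x =>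
      mul_nonneg (inv_nonneg.2 (pow_nonneg (hpos x).le n)) measureReal_nonneg
  have hω0 : volume (ball (0 : E) 1) ≠ 0 := (measure_ball_pos _ _ one_pos).ne'
  have hωt : volume (ball (0 : E) 1) ≠ ∞ := measure_ball_lt_top.ne
  have h1 : ENNReal.ofReal ((1 / 8) ^ n * s ^ 2) * volume (ball (0 : E) 1) ≤
      ENNReal.ofReal (5 ^ n / Λ * C₀ * J) * volume (ball (0 : E) 1) := by
    calc _ = volume (ball (0 : E) (1 / 8)) * ENNReal.ofReal s ^ 2 := by
          rw [Measure.addHaar_ball_of_pos _ _ (by norm_num : (0:ℝ) < 1 / 8),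
            ENNReal.ofReal_mul (by positivity), ENNReal.ofReal_pow hs]
          ring
      _ ≤ volume (ball (0 : E) (1 / 8)) * σ K ^ 2 :=
          mul_le_mul_right (pow_le_pow_left₀ zero_le hsK 2) _
      _ ≤ _ := hE
      _ ≤ _ := mul_le_mul' hΩ hJ1
      _ = _ := by
        rw [ENNReal.ofReal_mul (by positivity), ENNReal.ofReal_mul (by positivity)]
        ring
  rw [ENNReal.mul_le_mul_iff_left hω0 hωt, ENNReal.ofReal_le_ofReal_iff (by positivity)] at h1
  have e40 : (40:ℝ) ^ n = 8 ^ n * 5 ^ n := by rw [← mul_pow]; norm_num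
  have h6 : (8:ℝ) ^ n * (1 / 8) ^ n = 1 := by rw [← mul_pow]; norm_num
  have h7 : (0:ℝ) < 8 ^ n := by positivity
  have h8 := mul_le_mul_of_nonneg_left h1 (mul_pos h7 hΛ).le
  rw [div_le_iff₀ (by positivity), e40]
  have e1 : (8:ℝ) ^ n * Λ * ((1 / 8) ^ n * s ^ 2) = s ^ 2 * Λ := by
    calc _ = (8 ^ n * (1 / 8) ^ n) * (s ^ 2 * Λ) := by ring
      _ = _ := by rw [h6, one_mul]
  have e2 : (8:ℝ) ^ n * Λ * (5 ^ n / Λ * C₀ * J) = J * (8 ^ n * 5 ^ n * C₀) := by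
    field_simp
  rwa [e1, e2] at h8

end

section

variable {σ : Measure E} [IsFiniteMeasure σ] {β : E → E}

/-- Testing the almost-vanishing directional derivative of `σ` against a cut-off of `φ`. -/
theorem energy_le_of_test {χ φ P Q : E → ℝ} (hχ : ContDiff ℝ 1 χ) (hφ : ContDiff ℝ 1 φ)
    (hχs : tsupport χ ⊆ closedBall 0 2) (hχ0 : ∀ x, 0 ≤ χ x) (hχ1 : ∀ x, χ x ≤ 1)
    {K : Set E} (hK : MeasurableSet K) (hK1 : K ⊆ closedBall 0 2) (hχK : ∀ x ∈ K, χ x = 1)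
    {v : E} (hv : ‖v‖ ≤ 1) (hP : Integrable P σ) (hQ : Integrable Q σ) (hP0 : ∀ x, 0 ≤ P x)
    (hQ0 : ∀ x, 0 ≤ Q x)
    (hPQ : ∀ x, P x - Q x ≤ fderiv ℝ φ x v) {C D θ ε : ℝ} (hC : ∀ x, ‖fderiv ℝ χ x‖ ≤ C)
    (hD : ∀ x ∈ closedBall (0 : E) 2, ‖fderiv ℝ φ x‖ ≤ D)
    (hθ : ∀ x ∈ closedBall (0 : E) 2, |φ x - φ 0| ≤ θ)
    (htest : ∀ ψ : E → ℝ, ContDiff ℝ 1 ψ → tsupport ψ ⊆ closedBall 0 2 → ∀ L,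
      (∀ x, ‖fderiv ℝ ψ x‖ ≤ L) → |∫ x, fderiv ℝ ψ x v ∂σ| ≤ ε * L) :
    ∫ x in K, P x ∂σ ≤ ∫ x in closedBall 0 2, Q x ∂σ + θ * C * σ.real (closedBall 0 2) +
      ε * (D + θ * C) := by
  set ψ : E → ℝ := fun x => χ x * (φ x - φ 0) with hψ
  have hψd : ContDiff ℝ 1 ψ := hχ.mul (hφ.sub contDiff_const)
  have hψs : tsupport ψ ⊆ closedBall 0 2 := (tsupport_mul_subset_left).trans hχs
  have hθ0 : 0 ≤ θ := (abs_nonneg _).trans (hθ 0 (by simp))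
  have hC0 : 0 ≤ C := (norm_nonneg _).trans (hC 0)
  have hD0 : 0 ≤ D := (norm_nonneg _).trans (hD 0 (by simp))
  have hfd : ∀ x, fderiv ℝ ψ x = χ x • fderiv ℝ φ x + (φ x - φ 0) • fderiv ℝ χ x := by
    intro x
    have h1 := (hχ.differentiable (by simp) x).hasFDerivAt.mul
      (((hφ.differentiable (by simp) x).hasFDerivAt).sub_const (φ 0))
    exact h1.fderiv
  have hχout : ∀ x, x ∉ closedBall (0 : E) 2 → χ x = 0 := fun x hx =>
    image_eq_zero_of_notMem_tsupport fun h => hx (hχs h)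
  have hdχout : ∀ x, x ∉ closedBall (0 : E) 2 → fderiv ℝ χ x = 0 := fun x hx =>
    image_eq_zero_of_notMem_tsupport fun h => hx (hχs (tsupport_fderiv_subset ℝ h))
  have hL : ∀ x, ‖fderiv ℝ ψ x‖ ≤ D + θ * C := by
    intro x
    by_cases hx : x ∈ closedBall (0 : E) 2
    · rw [hfd]
      refine (norm_add_le _ _).trans (add_le_add ?_ ?_)
      · rw [norm_smul, Real.norm_of_nonneg (hχ0 x)]
        exact (mul_le_of_le_one_left (norm_nonneg _) (hχ1 x)).trans (hD x hx)
      · rw [norm_smul]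
        exact mul_le_mul (hθ x hx) (hC x) (norm_nonneg _) hθ0
    · rw [hfd, hχout x hx, hdχout x hx]
      simp only [zero_smul, smul_zero, add_zero, norm_zero]
      positivity
  have ht := htest ψ hψd hψs _ hL
  have hcχ : HasCompactSupport χ :=
    HasCompactSupport.of_support_subset_isCompact (isCompact_closedBall 0 2)
      ((subset_tsupport _).trans hχs)
  have hi1 : Integrable (fun x => χ x * fderiv ℝ φ x v) σ :=
    (Continuous.integrable_of_hasCompactSupport
      (hχ.continuous.mul ((hφ.continuous_fderiv (by simp)).clm_apply continuous_const))
      hcχ.mul_right)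
  have hi2 : Integrable (fun x => (φ x - φ 0) * fderiv ℝ χ x v) σ := by
    refine Continuous.integrable_of_hasCompactSupport
      ((hφ.continuous.sub continuous_const).mul
        ((hχ.continuous_fderiv (by simp)).clm_apply continuous_const)) ?_
    exact (hcχ.fderiv_apply ℝ v).mul_left
  have hsplit : ∫ x, fderiv ℝ ψ x v ∂σ =
      ∫ x, χ x * fderiv ℝ φ x v ∂σ + ∫ x, (φ x - φ 0) * fderiv ℝ χ x v ∂σ := by
    rw [← integral_add hi1 hi2]
    refine integral_congr_ae (Eventually.of_forall fun x => ?_)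
    simp [hfd]
  have hsecond : |∫ x, (φ x - φ 0) * fderiv ℝ χ x v ∂σ| ≤ θ * C * σ.real (closedBall 0 2) := by
    have e : ∫ x, (φ x - φ 0) * fderiv ℝ χ x v ∂σ =
        ∫ x in closedBall 0 2, (φ x - φ 0) * fderiv ℝ χ x v ∂σ := by
      refine (setIntegral_eq_integral_of_forall_compl_eq_zero fun x hx => ?_).symm
      simp [hdχout x hx]
    rw [e, ← Real.norm_eq_abs]
    refine norm_setIntegral_le_of_norm_le_const (measure_lt_top _ _) fun x hx => ?_
    rw [norm_mul]
    exact mul_le_mul (hθ x hx) (((fderiv ℝ χ x).le_opNorm v).trans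
      ((mul_le_of_le_one_right (norm_nonneg _) hv).trans (hC x))) (norm_nonneg _) hθ0
  have hfirst : ∫ x in K, P x ∂σ - ∫ x in closedBall 0 2, Q x ∂σ ≤
      ∫ x, χ x * fderiv ℝ φ x v ∂σ := by
    rw [← integral_indicator hK, ← integral_indicator measurableSet_closedBall,
      ← integral_sub (hP.indicator hK) (hQ.indicator measurableSet_closedBall)]
    refine integral_mono ((hP.indicator hK).sub (hQ.indicator measurableSet_closedBall)) hi1
      fun x => ?_
    have hx := hPQ x
    have hx0 := hχ0 x
    have hx1 := hχ1 x
    have hp := hP0 x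
    have hq := hQ0 x
    by_cases hxK : x ∈ K
    · simp only [indicator_of_mem hxK, indicator_of_mem (hK1 hxK), hχK x hxK]
      linarith
    · by_cases hxB : x ∈ closedBall (0 : E) 2
      · simp only [indicator_of_notMem hxK, indicator_of_mem hxB]
        nlinarith
      · simp only [indicator_of_notMem hxK, indicator_of_notMem hxB, hχout x hxB]
        simp
  have a1 := abs_le.1 ht
  have a2 := abs_le.1 hsecond
  linarith [a1.2, a2.1]

end

section

variable {σ : Measure E} [IsFiniteMeasure σ] {β : E → E}

theorem measureReal_closedBall_two_mul_le {h : E → ℝ} {Θ : ℝ} (hΘ : 0 ≤ Θ) {x : E} (hpos : 0 < h x)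
    (hx : σ (closedBall x (4 * h x)) ≤ ENNReal.ofReal (Θ * h x ^ Module.finrank ℝ E)) :
    (h x ^ Module.finrank ℝ E)⁻¹ * σ.real (closedBall x (2 * h x)) ≤ Θ := by
  have h1 : σ.real (closedBall x (2 * h x)) ≤ Θ * h x ^ Module.finrank ℝ E := by
    refine ENNReal.toReal_le_of_le_ofReal (by positivity) ((measure_mono ?_).trans hx)
    exact closedBall_subset_closedBall (by linarith)
  rw [inv_mul_le_iff₀ (by positivity)]
  linarith

theorem volume_closedBall_four_mul {r : ℝ} (hr : 0 < r) (y : E) :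
    volume (closedBall y (4 * r)) = ENNReal.ofReal
      (4 ^ Module.finrank ℝ E * volume.real (ball (0 : E) 1) * r ^ Module.finrank ℝ E) := by
  rw [Measure.addHaar_closedBall _ _ (by positivity), ← ofReal_measureReal measure_ball_lt_top.ne,
    ← ENNReal.ofReal_mul (by positivity)]
  congr 1
  ring

/-- A mollified potential has controlled oscillation. -/
theorem exists_potential_bounds {C₀ Θ κ : ℝ} (hC₀ : 0 ≤ C₀) (hΘ : 0 ≤ Θ) (hκ1 : κ ≤ 1 / 32)
    {h φ : E → ℝ} (hh : ContDiff ℝ 1 h) (hκ : ∀ x, ‖fderiv ℝ h x‖ ≤ κ) (hpos : ∀ x, 0 < h x)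
    (hh1 : ∀ x ∈ closedBall (0 : E) 3, h x ≤ 1 / 64)
    (hσ : σ (closedBall 0 3) ≤ ENNReal.ofReal C₀)
    (hΘσ : ∀ x ∈ closedBall 0 3, σ (closedBall x (4 * h x)) ≤
        ENNReal.ofReal (Θ * h x ^ Module.finrank ℝ E))
    (hφ : ContDiff ℝ 1 φ) {M : ℝ} (hM : 0 ≤ M)
    (hφ1 : ∀ x, ‖fderiv ℝ φ x‖ ≤
        2 * (M * (h x ^ Module.finrank ℝ E)⁻¹ * σ.real (closedBall x (2 * h x))))
    {t : ℝ} (ht : 0 < t) (ht1 : t ≤ 1 / 2) :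
    (∀ x ∈ closedBall (0 : E) 3, ‖fderiv ℝ φ x‖ ≤ 2 * M * Θ) ∧
    ∀ x ∈ closedBall (0 : E) 2, |φ x - φ 0| ≤ 2 * (2 * M * Θ) * t +
      2 * M * (2 ^ Module.finrank ℝ E * (4 ^ Module.finrank ℝ E * volume.real (ball (0 : E) 1))) *
        C₀ * 4 / volume.real (closedBall (0 : E) t) := by
  set n := Module.finrank ℝ E with hn
  have hlip := abs_sub_le_of_norm_fderiv_le hh hκ
  have hL : ∀ x ∈ closedBall (0 : E) 3, ‖fderiv ℝ φ x‖ ≤ 2 * M * Θ := by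
    intro x hx
    refine (hφ1 x).trans ?_
    have := measureReal_closedBall_two_mul_le hΘ (hpos x) (hΘσ x hx)
    calc _ = 2 * M * ((h x ^ n)⁻¹ * σ.real (closedBall x (2 * h x))) := by ring
      _ ≤ _ := mul_le_mul_of_nonneg_left this (by positivity)
  refine ⟨hL, fun x hx => ?_⟩
  have hS : ∫ z in closedBall (0 : E) (5 / 2), ‖fderiv ℝ φ z‖ ≤
      2 * M * (2 ^ n * (4 ^ n * volume.real (ball (0 : E) 1))) * C₀ := by
    have h1 := integral_norm_le_of_averaged (σ := σ) (τ := (volume : Measure E)) hh.continuous hpos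
      (B := closedBall (0 : E) (5 / 2)) (B' := closedBall (0 : E) 3) measurableSet_closedBall
      measurableSet_closedBall (fun x hx y hy => by
        refine ⟨?_, radius_comparable hκ1 hlip hpos hy⟩
        have h2 := hh1 x (closedBall_subset_closedBall (by norm_num) hx)
        rw [mem_closedBall] at *
        linarith [dist_triangle y x 0]) (Θ := 4 ^ n * volume.real (ball (0 : E) 1))
      (fun y _ => (volume_closedBall_four_mul (hpos y) y).le) (by positivity)
      (g := fun _ => 1) stronglyMeasurable_const (fun _ => zero_le_one) (integrable_const _)
      (M := 2 * M) (by positivity) (f := fun z => ‖fderiv ℝ φ z‖)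
      ((hφ.continuous_fderiv (by simp)).norm.aestronglyMeasurable) (fun _ => norm_nonneg _)
      (fun x => by
        refine (hφ1 x).trans (le_of_eq ?_)
        simp only [integral_const, smul_eq_mul, mul_one, measureReal_restrict_apply_univ]
        ring)
    refine h1.trans (mul_le_mul_of_nonneg_left ?_ (by positivity))
    simp only [integral_const, smul_eq_mul, mul_one, measureReal_restrict_apply_univ]
    exact ENNReal.toReal_le_of_le_ofReal hC₀ hσ
  have h3 := abs_sub_le_of_fderiv hφ (L := 2 * M * Θ)
    (S := 2 * M * (2 ^ n * (4 ^ n * volume.real (ball (0 : E) 1))) * C₀) (R := 2) ht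
    (fun z hz => hL z (closedBall_subset_closedBall (by linarith) hz)) ((setIntegral_mono_set
      ((hφ.continuous_fderiv (by simp)).norm.continuousOn.integrableOn_compact
        (isCompact_closedBall _ _))
      (Eventually.of_forall fun _ => norm_nonneg _)
      (closedBall_subset_closedBall (by linarith)).eventuallyLE).trans hS) hx
    (y := 0) (by simp)
  refine h3.trans (le_of_eq ?_)
  ring

end

section

variable {σ : Measure E} [IsFiniteMeasure σ] {β : E → E}

theorem setIntegral_averaged_le {Θ κ ε : ℝ} (hΘ : 0 ≤ Θ) (hκ1 : κ ≤ 1 / 32)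
    {h : E → ℝ} (hh : ContDiff ℝ 1 h) (hκ : ∀ x, ‖fderiv ℝ h x‖ ≤ κ) {h₀ : ℝ} (h₀pos : 0 < h₀)
    (hh₀ : ∀ x, h₀ ≤ h x)
    (hh1 : ∀ x ∈ closedBall (0 : E) 3, h x ≤ 1 / 64)
    (hΘσ : ∀ x ∈ closedBall 0 3, σ (closedBall x (4 * h x)) ≤
        ENNReal.ofReal (Θ * h x ^ Module.finrank ℝ E))
    {M : ℝ} (hM : 0 ≤ M) {g : E → ℝ} (hg : StronglyMeasurable g) (hg0 : ∀ x, 0 ≤ g x)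
    {C : ℝ} (hgC : ∀ x, ‖g x‖ ≤ C) (hgε : ∫ x in closedBall 0 3, g x ∂σ ≤ ε) :
    ∫ x in closedBall 0 2, M * (h x ^ Module.finrank ℝ E)⁻¹ *
      ∫ y in closedBall x (2 * h x), g y ∂σ ∂σ ≤ M * (2 ^ Module.finrank ℝ E * Θ) * ε := by
  set n := Module.finrank ℝ E with hn
  have hlip := abs_sub_le_of_norm_fderiv_le hh hκ
  have hpos : ∀ x, 0 < h x := fun x => h₀pos.trans_le (hh₀ x)
  refine (integral_norm_le_of_averaged (σ := σ) (τ := σ) hh.continuous hpos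
      (B := closedBall (0 : E) 2) (B' := closedBall (0 : E) 3) measurableSet_closedBall
      measurableSet_closedBall (fun x hx y hy => by
        refine ⟨?_, radius_comparable hκ1 hlip hpos hy⟩
        have h2 := hh1 x (closedBall_subset_closedBall (by norm_num) hx)
        rw [mem_closedBall] at *
        linarith [dist_triangle y x 0]) hΘσ hΘ hg hg0
      (Integrable.of_bound hg.aestronglyMeasurable C (Eventually.of_forall hgC)) hM
      (integrable_averaged hh.continuous h₀pos hh₀ (r := fun x => 2 * h x)
        (hh.continuous.const_mul 2) hg hgC M n).aestronglyMeasurable.restrict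
      (fun x => ?_) (fun x => le_rfl)).trans (mul_le_mul_of_nonneg_left hgε (by positivity))
  exact mul_nonneg (mul_nonneg hM (inv_nonneg.2 (pow_nonneg (hpos x).le n)))
    (integral_nonneg hg0)

end

variable (E) in
/-- A cut-off function for the unit ball supported in the ball of radius two. -/
theorem exists_cutoff : ∃ χ : E → ℝ, ∃ C : ℝ, 0 < C ∧ ContDiff ℝ 1 χ ∧
    tsupport χ ⊆ closedBall 0 2 ∧ (∀ x, 0 ≤ χ x) ∧ (∀ x, χ x ≤ 1) ∧
    (∀ x ∈ closedBall (0 : E) 1, χ x = 1) ∧ ∀ x, ‖fderiv ℝ χ x‖ ≤ C := by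
  let f : ContDiffBump (0 : E) := ⟨1, 2, one_pos, one_lt_two⟩
  obtain ⟨C, hC⟩ := exists_norm_fderiv_le f.contDiff f.hasCompactSupport
  exact ⟨f, max C 1, by positivity, f.contDiff, f.tsupport_eq.le, fun x => f.nonneg,
    fun x => f.le_one, fun x hx => f.one_of_mem_closedBall hx,
    fun x => (hC x).trans (le_max_left _ _)⟩

/-- A curl-free measure that is almost unidirectional, and almost invariant in a direction not
orthogonal to it, cannot concentrate on a Lebesgue-null set. -/
theorem exists_measureReal_lt {C₀ c : ℝ} (hC₀ : 0 < C₀) (hc : 0 < c) :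
    ∃ ε : ℝ, 0 < ε ∧ ∀ (σ : Measure E) [IsFiniteMeasure σ] (β : E → E) (b v : E) (K : Set E),
      StronglyMeasurable β → (∀ x, ‖β x‖ ≤ 1) → IsCurlFree σ β → ‖v‖ ≤ 1 → c ≤ ⟪b, v⟫_ℝ →
      σ (closedBall 0 5) ≤ ENNReal.ofReal C₀ → ∫ y in closedBall 0 3, ‖β y - b‖ ∂σ ≤ ε →
      (∀ ψ : E → ℝ, ContDiff ℝ 1 ψ → tsupport ψ ⊆ closedBall 0 2 → ∀ L,
        (∀ x, ‖fderiv ℝ ψ x‖ ≤ L) → |∫ x, fderiv ℝ ψ x v ∂σ| ≤ ε * L) →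
      IsCompact K → K ⊆ closedBall 0 1 → volume K = 0 → σ.real K < 1 / 2 := by
  set n := Module.finrank ℝ E with hn
  obtain ⟨χ, C, hC0, hχd, hχs, hχ0, hχ1, hχK, hχC⟩ := exists_cutoff E
  set κ := min (1 / 32) (c / 2) with hκdef
  have hκ0 : 0 < κ := by positivity
  have hκ1 : κ ≤ 1 / 32 := min_le_left _ _
  have hκ2 : κ ≤ c / 2 := min_le_right _ _
  set A := (2 / κ) ^ n with hA
  have hA0 : 0 < A := by positivity
  set M := bumpMax E with hMdef
  have hM0 : 0 < M := bumpMax_pos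
  set S := 2 * M * (2 ^ n * (4 ^ n * volume.real (ball (0 : E) 1))) * C₀ with hS
  have hS0 : 0 ≤ S := by positivity
  set P₀ := c / 2 * M * ((1 / 4) ^ 2 / (40 ^ n * C₀)) with hP₀
  have hP₀0 : 0 < P₀ := by positivity
  set θ := P₀ / (4 * C * C₀) with hθ
  have hθ0 : 0 < θ := by positivity
  set t := min (1 / 2) (θ / (8 * M * A)) with ht
  have ht0 : 0 < t := by positivity
  have ht1 : t ≤ 1 / 2 := min_le_left _ _
  have ht2 : t * (8 * M * A) ≤ θ := (le_div_iff₀ (by positivity)).1 (min_le_right _ _)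
  set V := volume.real (closedBall (0 : E) t) with hV
  have hV0 : 0 < V := ENNReal.toReal_pos (measure_closedBall_pos _ _ ht0).ne'
    measure_closedBall_lt_top.ne
  set Λ := max (20 ^ n * C₀ + 1) (8 * S / (V * θ)) with hΛ
  have hΛ1 : 20 ^ n * C₀ < Λ := (lt_add_one _).trans_le (le_max_left _ _)
  have hΛ0 : 0 < Λ := lt_trans (by positivity) hΛ1
  have hΛ2 : 8 * S ≤ Λ * (V * θ) := (div_le_iff₀ (by positivity)).1 (le_max_right _ _)
  set ε := P₀ / (4 * (M * (2 ^ n * A) + 2 * M * A + θ * C)) with hε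
  have hε0 : 0 < ε := by positivity
  refine ⟨ε, hε0, ?_⟩
  intro σ _ β b v K hβ hβ1 hcurl hv hbv hσ hβε htest hKc hK1 hK0
  by_contra! hσK
  obtain ⟨ρ, hρ0, hρ1, hρK⟩ := exists_scale_measure_inter_goodSet_le σ hΛ0 hKc hK0
    (δ := ENNReal.ofReal (1 / 4)) (by simp)
  obtain ⟨h, hh, hhκ, hhρ, hh1, hhσ, hhsub⟩ := exists_radius hσ hC₀ hΛ1 hρ0 hρ1 hκ0 hκ1
  have h₀pos : 0 < κ * ρ := by positivity
  have hpos : ∀ x, 0 < h x := fun x => h₀pos.trans_le (hhρ x)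
  have hlip := abs_sub_le_of_norm_fderiv_le hh hhκ
  obtain ⟨φ, hφd, hφlow, hφup⟩ := exists_variable_mollification hβ hβ1 hcurl hh h₀pos hhρ
    (hκ1.trans (by norm_num)) hhκ
  simp only [← hMdef, ← hn] at hφlow hφup hhσ
  have hσ3 : σ (closedBall 0 3) ≤ ENNReal.ofReal C₀ :=
    (measure_mono (closedBall_subset_closedBall (by norm_num))).trans hσ
  have hσ2 : σ.real (closedBall 0 2) ≤ C₀ := ENNReal.toReal_le_of_le_ofReal hC₀.le
    ((measure_mono (closedBall_subset_closedBall (by norm_num))).trans hσ)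
  obtain ⟨hφL, hφosc⟩ := exists_potential_bounds hC₀.le (by positivity : 0 ≤ Λ * A) hκ1 hh hhκ
    hpos hh1 hσ3 hhσ hφd hM0.le hφup ht0 ht1
  have hosc : ∀ x ∈ closedBall (0 : E) 2, |φ x - φ 0| ≤ θ * Λ := by
    intro x hx
    refine (hφosc x hx).trans ?_
    rw [← hn, ← hS, ← hV]
    have e1 : S * 4 / V ≤ θ * Λ / 2 := by
      rw [div_le_iff₀ hV0]
      linarith
    have e2 : 2 * (2 * M * (Λ * A)) * t ≤ θ * Λ / 2 := by
      have := mul_le_mul_of_nonneg_left ht2 hΛ0.le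
      linarith
    linarith
  set K' := K ∩ (goodSet σ ρ Λ)ᶜ with hK'
  have hK'm : MeasurableSet K' :=
    hKc.measurableSet.inter (isClosed_goodSet σ ρ Λ).measurableSet.compl
  have hK'1 : K' ⊆ closedBall 0 1 := inter_subset_left.trans hK1
  have hσK' : ENNReal.ofReal (1 / 4) ≤ σ K' := by
    have h1 : σ K = σ (K ∩ goodSet σ ρ Λ) + σ K' :=
      (measure_inter_add_sdiff K (isClosed_goodSet σ ρ Λ).measurableSet).symm
    have h2 : ENNReal.ofReal (1 / 4) + ENNReal.ofReal (1 / 4) ≤ σ K := by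
      rw [← ENNReal.ofReal_add (by norm_num) (by norm_num), ← ofReal_measureReal]
      exact ENNReal.ofReal_le_ofReal (by linarith)
    rw [h1] at h2
    exact (ENNReal.add_le_add_iff_left ENNReal.ofReal_ne_top).1
      (h2.trans (add_le_add_left hρK _))
  have hE := le_setIntegral_energy (σ := σ) hh.continuous h₀pos hhρ hK'm
    (Ω := ⋃ x ∈ (goodSet σ ρ Λ)ᶜ ∩ closedBall 0 4, closedBall x ρ)
    (fun x hx => hhsub x ⟨hx.2, hK'1 hx⟩)
    (fun x _ y _ hxy => (radius_comparable hκ1 hlip hpos (by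
      have h1 := abs_le.1 (hlip x y)
      have h2 := hpos x
      have h3 := dist_nonneg (x := x) (y := y)
      rw [dist_comm]
      nlinarith [h1.1, h1.2])).1) hC₀ hΛ0 (s := 1 / 4) (by norm_num) hσK' (by
        refine (volume_iUnion_goodSet_compl_le σ hρ0 hΛ0 4).trans ?_
        rw [show (4 : ℝ) + 1 = 5 by norm_num]
        exact mul_le_mul_right hσ _)
  have hgm : StronglyMeasurable fun y => ‖β y - b‖ := (hβ.sub stronglyMeasurable_const).norm
  have hgC : ∀ y, ‖‖β y - b‖‖ ≤ 1 + ‖b‖ := fun y => by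
    rw [norm_norm]
    exact (norm_sub_le _ _).trans (add_le_add_left (hβ1 y) _)
  have hQle := setIntegral_averaged_le (σ := σ) (by positivity : 0 ≤ Λ * A) hκ1 hh hhκ h₀pos hhρ hh1
    hhσ hM0.le hgm (fun _ => norm_nonneg _) hgC hβε
  have hPint : Integrable (fun x => (h x ^ n)⁻¹ * σ.real (closedBall x (h x / 2))) σ := by
    simpa using integrable_averaged (σ := σ) hh.continuous h₀pos hhρ (r := fun x => h x / 2)
      (hh.continuous.div_const 2) (g := fun _ => 1) stronglyMeasurable_const (A := 1)
      (fun _ => by simp) 1 n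
  have hfin := energy_le_of_test (σ := σ) hχd hφd hχs hχ0 hχ1 hK'm
    (hK'1.trans (closedBall_subset_closedBall (by norm_num))) (fun x hx => hχK x (hK'1 hx)) hv
    (P := fun x => c / 2 * M * ((h x ^ n)⁻¹ * σ.real (closedBall x (h x / 2))))
    (Q := fun x => M * (h x ^ n)⁻¹ * ∫ y in closedBall x (2 * h x), ‖β y - b‖ ∂σ)
    (hPint.const_mul _)
    (integrable_averaged hh.continuous h₀pos hhρ (r := fun x => 2 * h x)
        (hh.continuous.const_mul 2) hgm hgC M n)
    (fun x => mul_nonneg (by positivity) (mul_nonneg (inv_nonneg.2 (pow_nonneg (hpos x).le n))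
      measureReal_nonneg))
    (fun x => mul_nonneg (mul_nonneg hM0.le (inv_nonneg.2 (pow_nonneg (hpos x).le n)))
      (integral_nonneg fun _ => norm_nonneg _))
    (fun x => by
      refine le_trans ?_ (hφlow x b v hv (by linarith))
      have h1 : 0 ≤ M * (h x ^ n)⁻¹ := mul_nonneg hM0.le (inv_nonneg.2 (pow_nonneg (hpos x).le n))
      have h2 : c / 2 * σ.real (closedBall x (h x / 2)) ≤
          (⟪b, v⟫_ℝ - κ) * σ.real (closedBall x (h x / 2)) :=
        mul_le_mul_of_nonneg_right (by linarith) measureReal_nonneg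
      have h3 := mul_le_mul_of_nonneg_left h2 h1
      rw [mul_sub]
      linarith)
    hχC (fun x hx => hφL x (closedBall_subset_closedBall (by norm_num) hx)) hosc htest
  rw [integral_const_mul] at hfin
  have hE' := mul_le_mul_of_nonneg_left hE (by positivity : 0 ≤ c / 2 * M)
  have e1 : c / 2 * M * ((1 / 4) ^ 2 * Λ / (40 ^ n * C₀)) = P₀ * Λ := by
    rw [hP₀]; ring
  have e2 : θ * Λ * C * σ.real (closedBall 0 2) ≤ P₀ * Λ / 4 := by
    have : θ * Λ * C * C₀ = P₀ * Λ / 4 := by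
      rw [hθ]; field_simp
    rw [← this]
    exact mul_le_mul_of_nonneg_left hσ2 (by positivity)
  have e3 : ε * (M * (2 ^ n * A) + 2 * M * A + θ * C) * Λ = P₀ * Λ / 4 := by
    rw [hε]; field_simp
  have e4 : 0 < P₀ * Λ := by positivity
  have e5 : M * (2 ^ n * (Λ * A)) * ε + ε * (2 * M * (Λ * A) + θ * Λ * C) = P₀ * Λ / 4 := by
    rw [← e3]; ring
  have e6 : P₀ * Λ ≤ _ := e1.symm.le.trans (hE'.trans hfin)
  linarith only [e6, hQle, e2, e4, e5]

/-- Smooth approximation of `C¹` functions with compact support. -/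
theorem exists_smooth_approx {ψ : E → ℝ} (hψ : ContDiff ℝ 1 ψ) (hc : HasCompactSupport ψ) :
    ∃ (φ : ℕ → E → ℝ) (C : ℝ), (∀ k, ContDiff ℝ (⊤ : ℕ∞) (φ k)) ∧ (∀ k, HasCompactSupport (φ k)) ∧
      (∀ k x, ‖fderiv ℝ (φ k) x‖ ≤ C) ∧
      ∀ x, Tendsto (fun k => fderiv ℝ (φ k) x) atTop (𝓝 (fderiv ℝ ψ x)) := by
  let f : ℕ → ContDiffBump (0 : E) := fun k =>
    ⟨1 / ((k : ℝ) + 1) / 2, 1 / ((k : ℝ) + 1), by positivity, half_lt_self (by positivity)⟩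
  have hr : Tendsto (fun k => (f k).rOut) atTop (𝓝 0) := tendsto_one_div_add_atTop_nhds_zero_nat
  have hdc : Continuous (fderiv ℝ ψ) := hψ.continuous_fderiv (by simp)
  obtain ⟨C, hC⟩ := (hc.fderiv ℝ).exists_bound_of_continuous hdc
  have hfd : ∀ k x, fderiv ℝ ((f k).normed volume ⋆[ContinuousLinearMap.lsmul ℝ ℝ, volume] ψ) x =
      ((f k).normed volume ⋆[ContinuousLinearMap.lsmul ℝ ℝ, volume] fderiv ℝ ψ) x := by
    intro k x
    have h1 := (hc.hasFDerivAt_convolution_right (μ := volume) (ContinuousLinearMap.lsmul ℝ ℝ)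
      ((f k).continuous_normed (μ := volume)).locallyIntegrable hψ x).fderiv
    rw [h1]
    rfl
  refine ⟨fun k => (f k).normed volume ⋆[ContinuousLinearMap.lsmul ℝ ℝ, volume] ψ, C + 2 * C,
    fun k => ?_, fun k => ?_, fun k x => ?_, fun x => ?_⟩
  · exact (f k).hasCompactSupport_normed.contDiff_convolution_left _ (f k).contDiff_normed
      hψ.continuous.locallyIntegrable
  · exact HasCompactSupport.convolution _ (f k).hasCompactSupport_normed hc
  · rw [hfd]
    have h1 := (f k).dist_normed_convolution_le (μ := volume) (x₀ := x) (g := fderiv ℝ ψ)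
      (ε := 2 * C) hdc.aestronglyMeasurable (fun y _ => by
        rw [dist_eq_norm]
        exact (norm_sub_le _ _).trans (by linarith [hC y, hC x]))
    rw [dist_eq_norm] at h1
    calc _ ≤ ‖fderiv ℝ ψ x‖ + _ := norm_le_norm_add_norm_sub' _ _
      _ ≤ _ := add_le_add (hC x) h1
  · simp only [hfd]
    exact ContDiffBump.convolution_tendsto_right_of_continuous hr hdc x

theorem IsCurlFree.of_contDiff_one {σ : Measure E} [IsFiniteMeasure σ] {β : E → E}
    (hcurl : IsCurlFree σ β) (hβ : StronglyMeasurable β) (hβ1 : ∀ x, ‖β x‖ ≤ 1) {ψ : E → ℝ}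
    (hψ : ContDiff ℝ 1 ψ) (hc : HasCompactSupport ψ) (v w : E) :
    ∫ x, (fderiv ℝ ψ x v * ⟪β x, w⟫_ℝ - fderiv ℝ ψ x w * ⟪β x, v⟫_ℝ) ∂σ = 0 := by
  obtain ⟨φ, C, hφ, hφc, hφC, hlim⟩ := exists_smooth_approx hψ hc
  have hi : ∀ w x, |⟪β x, w⟫_ℝ| ≤ ‖w‖ := fun w x =>
    (abs_real_inner_le_norm _ _).trans (mul_le_of_le_one_left (norm_nonneg _) (hβ1 x))
  have hp : ∀ k v w x, |fderiv ℝ (φ k) x v * ⟪β x, w⟫_ℝ| ≤ C * ‖v‖ * ‖w‖ := by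
    intro k v w x
    have h1 : ‖fderiv ℝ (φ k) x v‖ ≤ C * ‖v‖ := ((fderiv ℝ (φ k) x).le_opNorm v).trans
      (mul_le_mul_of_nonneg_right (hφC k x) (norm_nonneg _))
    rw [abs_mul]
    exact mul_le_mul h1 (hi w x) (abs_nonneg _) ((norm_nonneg _).trans h1)
  have key : Tendsto (fun k => ∫ x, (fderiv ℝ (φ k) x v * ⟪β x, w⟫_ℝ -
      fderiv ℝ (φ k) x w * ⟪β x, v⟫_ℝ) ∂σ) atTop
      (𝓝 (∫ x, (fderiv ℝ ψ x v * ⟪β x, w⟫_ℝ - fderiv ℝ ψ x w * ⟪β x, v⟫_ℝ) ∂σ)) := by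
    refine tendsto_integral_of_dominated_convergence (fun _ => C * ‖v‖ * ‖w‖ + C * ‖w‖ * ‖v‖)
      (fun k => ?_) (integrable_const _) (fun k => Eventually.of_forall fun x => ?_)
      (Eventually.of_forall fun x => ?_)
    · have hm : ∀ v w, StronglyMeasurable fun x => fderiv ℝ (φ k) x v * ⟪β x, w⟫_ℝ := fun v w =>
        (((hφ k).continuous_fderiv (by simp)).clm_apply continuous_const).stronglyMeasurable.mul
          (hβ.inner stronglyMeasurable_const)
      exact ((hm v w).sub (hm w v)).aestronglyMeasurable
    · exact (norm_sub_le _ _).trans (add_le_add (hp k v w x) (hp k w v x))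
    · have h1 : ∀ v, Tendsto (fun k => fderiv ℝ (φ k) x v) atTop (𝓝 (fderiv ℝ ψ x v)) := fun v =>
        ((ContinuousLinearMap.apply ℝ ℝ v).continuous.tendsto _).comp (hlim x)
      exact ((h1 v).mul_const _).sub ((h1 w).mul_const _)
  exact tendsto_nhds_unique key (by simp only [hcurl _ (hφ _) (hφc _), tendsto_const_nhds])

/-- If `β` is close to `b`, then `σ` is almost invariant in the directions orthogonal to `b`. -/
theorem IsCurlFree.abs_integral_fderiv_le {σ : Measure E} [IsFiniteMeasure σ] {β : E → E}
    (hcurl : IsCurlFree σ β) (hβ : StronglyMeasurable β) (hβ1 : ∀ x, ‖β x‖ ≤ 1) {b v : E}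
    (hb : b ≠ 0) (hv : ‖v‖ ≤ 1) (hbv : ⟪b, v⟫_ℝ = 0) {ψ : E → ℝ}
    (hψ : ContDiff ℝ 1 ψ) {R : ℝ} (hs : tsupport ψ ⊆ closedBall 0 R) {L : ℝ}
    (hL : ∀ x, ‖fderiv ℝ ψ x‖ ≤ L) :
    |∫ x, fderiv ℝ ψ x v ∂σ| ≤ 2 / ‖b‖ * (∫ x in closedBall 0 R, ‖β x - b‖ ∂σ) * L := by
  have hc : HasCompactSupport ψ :=
    HasCompactSupport.of_support_subset_isCompact (isCompact_closedBall 0 R)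
      ((subset_tsupport _).trans hs)
  have hdc : Continuous (fderiv ℝ ψ) := hψ.continuous_fderiv (by simp)
  have h0 := hcurl.of_contDiff_one hβ hβ1 hψ hc v b
  have hb0 : 0 < ‖b‖ := norm_pos_iff.2 hb
  have hL0 : 0 ≤ L := (norm_nonneg _).trans (hL 0)
  have hdi : Integrable (fun x => fderiv ℝ ψ x v) σ :=
    Continuous.integrable_of_hasCompactSupport (hdc.clm_apply continuous_const)
      (hc.fderiv_apply ℝ v)
  have hmeas : ∀ v w, StronglyMeasurable fun x => fderiv ℝ ψ x v * ⟪β x, w⟫_ℝ := fun v w =>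
    (hdc.clm_apply continuous_const).stronglyMeasurable.mul (hβ.inner stronglyMeasurable_const)
  have hbd : ∀ v w x, ‖fderiv ℝ ψ x v * ⟪β x, w⟫_ℝ‖ ≤ L * ‖v‖ * ‖w‖ := by
    intro v w x
    have h1 : ‖fderiv ℝ ψ x v‖ ≤ L * ‖v‖ := ((fderiv ℝ ψ x).le_opNorm v).trans
      (mul_le_mul_of_nonneg_right (hL x) (norm_nonneg _))
    rw [norm_mul]
    exact mul_le_mul h1 ((norm_inner_le_norm _ _).trans
      (mul_le_of_le_one_left (norm_nonneg _) (hβ1 x))) (norm_nonneg _) ((norm_nonneg _).trans h1)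
  have hi : ∀ v w, Integrable (fun x => fderiv ℝ ψ x v * ⟪β x, w⟫_ℝ) σ := fun v w =>
    Integrable.of_bound (hmeas v w).aestronglyMeasurable _ (Eventually.of_forall (hbd v w))
  set G : E → ℝ := fun x => fderiv ℝ ψ x v * ‖b‖ ^ 2 -
    (fderiv ℝ ψ x v * ⟪β x, b⟫_ℝ - fderiv ℝ ψ x b * ⟪β x, v⟫_ℝ) with hG
  have hG1 : ∫ x, G x ∂σ = (∫ x, fderiv ℝ ψ x v ∂σ) * ‖b‖ ^ 2 := by
    have h1 := integral_sub (hdi.mul_const (‖b‖ ^ 2)) ((hi v b).sub (hi b v))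
    simp only [Pi.sub_apply] at h1
    rw [hG, h1, h0, sub_zero, integral_mul_const]
  have hG2 : ∀ x, ‖G x‖ ≤ 2 * ‖b‖ * L * ‖β x - b‖ := by
    intro x
    have e : G x = fderiv ℝ ψ x v * ⟪b - β x, b⟫_ℝ + fderiv ℝ ψ x b * ⟪β x - b, v⟫_ℝ := by
      rw [hG, inner_sub_left, inner_sub_left, hbv, real_inner_self_eq_norm_sq]
      ring
    have hD : ∀ w, ‖fderiv ℝ ψ x w‖ ≤ L * ‖w‖ := fun w => ((fderiv ℝ ψ x).le_opNorm w).trans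
      (mul_le_mul_of_nonneg_right (hL x) (norm_nonneg _))
    have h1 : ‖fderiv ℝ ψ x v * ⟪b - β x, b⟫_ℝ‖ ≤ (L * 1) * (‖β x - b‖ * ‖b‖) := by
      rw [norm_mul]
      refine mul_le_mul ((hD v).trans (mul_le_mul_of_nonneg_left hv hL0)) ?_ (norm_nonneg _)
        (by positivity)
      rw [norm_sub_rev]
      exact norm_inner_le_norm _ _
    have h2 : ‖fderiv ℝ ψ x b * ⟪β x - b, v⟫_ℝ‖ ≤ (L * ‖b‖) * (‖β x - b‖ * 1) := by
      rw [norm_mul]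
      refine mul_le_mul (hD b) ((norm_inner_le_norm _ _).trans
        (mul_le_mul_of_nonneg_left hv (norm_nonneg _))) (norm_nonneg _) (by positivity)
    rw [e]
    refine (norm_add_le _ _).trans ?_
    linarith
  have hGout : ∀ x, x ∉ closedBall (0 : E) R → G x = 0 := by
    intro x hx
    have : fderiv ℝ ψ x = 0 :=
      image_eq_zero_of_notMem_tsupport fun h => hx (hs (tsupport_fderiv_subset ℝ h))
    simp [hG, this]
  have hfi : Integrable (fun x => ‖β x - b‖) σ :=
    Integrable.of_bound (hβ.sub stronglyMeasurable_const).norm.aestronglyMeasurable (1 + ‖b‖)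
      (Eventually.of_forall fun x => by
        rw [norm_norm]
        exact (norm_sub_le _ _).trans (add_le_add_left (hβ1 x) _))
  have hfin : |∫ x, fderiv ℝ ψ x v ∂σ| * ‖b‖ ^ 2 ≤
      2 * ‖b‖ * L * ∫ x in closedBall 0 R, ‖β x - b‖ ∂σ := by
    rw [← abs_of_nonneg (sq_nonneg ‖b‖), ← abs_mul, ← hG1,
      ← setIntegral_eq_integral_of_forall_compl_eq_zero hGout, ← integral_const_mul]
    refine norm_integral_le_of_norm_le (hfi.restrict.const_mul _) (Eventually.of_forall hG2)
  have : |∫ x, fderiv ℝ ψ x v ∂σ| = (|∫ x, fderiv ℝ ψ x v ∂σ| * ‖b‖ ^ 2) / ‖b‖ ^ 2 := by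
    field_simp
  rw [this, div_le_iff₀ (by positivity)]
  refine hfin.trans (le_of_eq ?_)
  field_simp

/-- Two curl-free fields with different directions cannot both be almost constant at unit scale
on a measure concentrated on a null set. -/
theorem exists_measureReal_lt_of_linearIndependent {C₀ : ℝ} (hC₀ : 0 < C₀) {b₁ b₂ : E}
    (hb : LinearIndependent ℝ ![b₁, b₂]) :
    ∃ ε : ℝ, 0 < ε ∧ ∀ (σ : Measure E) [IsFiniteMeasure σ] (β₁ β₂ : E → E) (K : Set E),
      StronglyMeasurable β₁ → (∀ x, ‖β₁ x‖ ≤ 1) → IsCurlFree σ β₁ →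
      StronglyMeasurable β₂ → (∀ x, ‖β₂ x‖ ≤ 1) → IsCurlFree σ β₂ →
      σ (closedBall 0 5) ≤ ENNReal.ofReal C₀ → ∫ y in closedBall 0 3, ‖β₁ y - b₁‖ ∂σ ≤ ε →
      ∫ y in closedBall 0 3, ‖β₂ y - b₂‖ ∂σ ≤ ε →
      IsCompact K → K ⊆ closedBall 0 1 → volume K = 0 → σ.real K < 1 / 2 := by
  have hb2 : b₂ ≠ 0 := by simpa using hb.ne_zero 1
  have hb20 : 0 < ‖b₂‖ := norm_pos_iff.2 hb2
  set u : E := b₁ - (⟪b₁, b₂⟫_ℝ / ‖b₂‖ ^ 2) • b₂ with hu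
  have hu0 : u ≠ 0 := by
    intro h
    have h2 := LinearIndependent.pair_iff.1 hb 1 (-(⟪b₁, b₂⟫_ℝ / ‖b₂‖ ^ 2)) (by
      rw [← h, hu]; module)
    exact one_ne_zero h2.1
  have hun : 0 < ‖u‖ := norm_pos_iff.2 hu0
  have hub2 : ⟪b₂, u⟫_ℝ = 0 := by
    rw [hu, inner_sub_right, inner_smul_right, real_inner_self_eq_norm_sq, real_inner_comm]
    field_simp
    ring
  have hub1 : ⟪b₁, u⟫_ℝ = ‖u‖ ^ 2 := by
    have h1 : b₁ = u + (⟪b₁, b₂⟫_ℝ / ‖b₂‖ ^ 2) • b₂ := by rw [hu]; abel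
    nth_rw 1 [h1]
    rw [inner_add_left, inner_smul_left, hub2, real_inner_self_eq_norm_sq]
    simp
  set v := ‖u‖⁻¹ • u with hv
  have hv1 : ‖v‖ ≤ 1 := by rw [hv, norm_smul, norm_inv, norm_norm, inv_mul_cancel₀ hun.ne']
  have hbv1 : ‖u‖ ≤ ⟪b₁, v⟫_ℝ := by
    rw [hv, inner_smul_right, hub1]
    exact le_of_eq (by field_simp)
  have hbv2 : ⟪b₂, v⟫_ℝ = 0 := by rw [hv, inner_smul_right, hub2, mul_zero]
  obtain ⟨ε, hε, key⟩ := exists_measureReal_lt (E := E) hC₀ hun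
  refine ⟨min ε (ε * ‖b₂‖ / 2), by positivity, ?_⟩
  intro σ _ β₁ β₂ K hβ₁ hβ₁1 hc₁ hβ₂ hβ₂1 hc₂ hσ h1 h2 hK hK1 hK0
  refine key σ β₁ b₁ v K hβ₁ hβ₁1 hc₁ hv1 hbv1 hσ (h1.trans (min_le_left _ _)) ?_ hK hK1 hK0
  intro ψ hψ hs L hL
  have hL0 : 0 ≤ L := (norm_nonneg _).trans (hL 0)
  refine (hc₂.abs_integral_fderiv_le hβ₂ hβ₂1 hb2 hv1 hbv2 hψ
    (hs.trans (closedBall_subset_closedBall (by norm_num : (2 : ℝ) ≤ 3))) hL).trans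
    (mul_le_mul_of_nonneg_right ?_ hL0)
  calc _ ≤ 2 / ‖b₂‖ * (ε * ‖b₂‖ / 2) :=
        mul_le_mul_of_nonneg_left (h2.trans (min_le_right _ _)) (by positivity)
    _ = ε := by field_simp

theorem frequently_doubling {m : ℝ → ℝ} {c : ℝ} (hc : 0 < c) (n : ℕ)
    (hm : ∀ᶠ r in 𝓝[>] 0, c * r ^ n ≤ m r) :
    ∃ᶠ r in 𝓝[>] 0, m (8 * r) ≤ 2 * 8 ^ n * m r := by
  intro hcon
  obtain ⟨r₀, hr₀, hsub⟩ := mem_nhdsGT_iff_exists_Ioc_subset.1 (hm.and hcon)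
  rw [mem_Ioi] at hr₀
  have hmem : ∀ k : ℕ, r₀ / 8 ^ k ∈ Ioc 0 r₀ := fun k =>
    ⟨by positivity, div_le_self hr₀.le (one_le_pow₀ (by norm_num))⟩
  have hind : ∀ k : ℕ, (2 * 8 ^ n) ^ k * m (r₀ / 8 ^ k) ≤ m r₀ := by
    intro k
    induction k with
    | zero => simp
    | succ k ih =>
      have h1 := (hsub (hmem (k + 1))).2
      rw [not_le, show 8 * (r₀ / 8 ^ (k + 1)) = r₀ / 8 ^ k by field_simp; ring] at h1
      calc _ = (2 * 8 ^ n) ^ k * (2 * 8 ^ n * m (r₀ / 8 ^ (k + 1))) := by ring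
        _ ≤ (2 * 8 ^ n) ^ k * m (r₀ / 8 ^ k) := mul_le_mul_of_nonneg_left h1.le (by positivity)
        _ ≤ _ := ih
  have hlow : ∀ k : ℕ, 2 ^ k * (c * r₀ ^ n) ≤ m r₀ := by
    intro k
    refine le_trans ?_ (hind k)
    have h1 := mul_le_mul_of_nonneg_left (hsub (hmem k)).1 (by positivity : (0:ℝ) ≤ (2 * 8 ^ n) ^ k)
    refine le_trans (le_of_eq ?_) h1
    rw [div_pow, mul_pow, ← pow_mul, ← pow_mul, mul_comm n k]
    field_simp
  obtain ⟨k, hk⟩ := pow_unbounded_of_one_lt (m r₀ / (c * r₀ ^ n)) (one_lt_two : (1:ℝ) < 2)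
  rw [div_lt_iff₀ (by positivity)] at hk
  linarith [hlow k]

/-- The affine map sending the ball of centre `x₀` and radius `r` to the unit ball. -/
noncomputable def rescaling (x₀ : E) {r : ℝ} (hr : r ≠ 0) : E ≃ₜ E where
  toFun x := r⁻¹ • (x - x₀)
  invFun y := x₀ + r • y
  left_inv x := by simp [smul_smul, hr]
  right_inv y := by simp [smul_smul, hr]
  continuous_toFun := by fun_prop
  continuous_invFun := by fun_prop

theorem rescaling_apply (x₀ : E) {r : ℝ} (hr : r ≠ 0) (x : E) :
    rescaling x₀ hr x = r⁻¹ • (x - x₀) := rfl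

theorem rescaling_preimage_closedBall (x₀ : E) {r : ℝ} (hr : 0 < r) (R : ℝ) :
    rescaling x₀ hr.ne' ⁻¹' closedBall 0 R = closedBall x₀ (R * r) := by
  ext x
  rw [mem_preimage, mem_closedBall, mem_closedBall, dist_zero_right, dist_eq_norm, rescaling_apply,
    norm_smul, norm_inv, Real.norm_of_nonneg hr.le, inv_mul_le_iff₀ hr, mul_comm]

theorem IsCurlFree.rescale {σ : Measure E} {β : E → E} (hcurl : IsCurlFree σ β) (x₀ : E) {r : ℝ}
    (hr : r ≠ 0) (a : ℝ≥0∞) :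
    IsCurlFree (a • σ.map (rescaling x₀ hr)) (fun y => β ((rescaling x₀ hr).symm y)) := by
  intro φ hφ hφc v w
  set e := rescaling x₀ hr with he
  have hfd : ∀ x v, fderiv ℝ φ (e x) v = r * fderiv ℝ (fun x => φ (e x)) x v := by
    intro x v
    have h1 : HasFDerivAt (fun x => e x) (r⁻¹ • ContinuousLinearMap.id ℝ E) x :=
      ((hasFDerivAt_id x).sub_const x₀).const_smul r⁻¹
    have h2 := ((hφ.differentiable (by simp) (e x)).hasFDerivAt.comp x h1).fderiv
    rw [show (fun x => φ (e x)) = φ ∘ fun x => e x from rfl, h2]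
    simp [hr]
  have h := hcurl (fun x => φ (e x)) (hφ.comp ((contDiff_id.sub contDiff_const).const_smul r⁻¹))
    (hφc.comp_homeomorph e) v w
  rw [integral_smul_measure, e.measurableEmbedding.integral_map]
  simp only [hfd, Homeomorph.symm_apply_apply, mul_assoc, ← mul_sub, integral_const_mul]
  rw [h, mul_zero, smul_zero]

theorem exists_measureReal_lt_of_doubling {C₀ : ℝ} (hC₀ : 0 < C₀) {b₁ b₂ : E}
    (hb : LinearIndependent ℝ ![b₁, b₂]) :
    ∃ ε : ℝ, 0 < ε ∧ ∀ (σ : Measure E) [IsFiniteMeasure σ] (β₁ β₂ : E → E) (K : Set E),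
      StronglyMeasurable β₁ → (∀ x, ‖β₁ x‖ ≤ 1) → IsCurlFree σ β₁ →
      StronglyMeasurable β₂ → (∀ x, ‖β₂ x‖ ≤ 1) → IsCurlFree σ β₂ → ∀ (x₀ : E) (r : ℝ), 0 < r →
      0 < σ.real (closedBall x₀ r) →
      σ.real (closedBall x₀ (5 * r)) ≤ C₀ * σ.real (closedBall x₀ r) →
      ∫ y in closedBall x₀ (3 * r), ‖β₁ y - b₁‖ ∂σ ≤ ε * σ.real (closedBall x₀ r) →
      ∫ y in closedBall x₀ (3 * r), ‖β₂ y - b₂‖ ∂σ ≤ ε * σ.real (closedBall x₀ r) →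
      IsCompact K → K ⊆ closedBall x₀ r → volume K = 0 →
      σ.real K < σ.real (closedBall x₀ r) / 2 := by
  obtain ⟨ε, hε, key⟩ := exists_measureReal_lt_of_linearIndependent hC₀ hb
  refine ⟨ε, hε, ?_⟩
  intro σ _ β₁ β₂ K hβ₁ hβ₁1 hc₁ hβ₂ hβ₂1 hc₂ x₀ r hr hs h5 h1 h2 hK hKs hK0
  set s := σ.real (closedBall x₀ r) with hsdef
  set e := rescaling x₀ hr.ne' with he
  set σ' := ENNReal.ofReal s⁻¹ • σ.map e with hσ'
  have : IsFiniteMeasure σ' := Measure.smul_finite _ ENNReal.ofReal_ne_top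
  have hreal : ∀ S, σ'.real S = s⁻¹ * σ.real (e ⁻¹' S) := by
    intro S
    rw [hσ', measureReal_ennreal_smul_apply, ENNReal.toReal_ofReal (by positivity),
      measureReal_def, e.measurableEmbedding.map_apply, ← measureReal_def]
  have hint : ∀ (β : E → E) (b : E), ∫ y in closedBall x₀ (3 * r), ‖β y - b‖ ∂σ ≤ ε * s →
      ∫ y in closedBall 0 3, ‖β (e.symm y) - b‖ ∂σ' ≤ ε := by
    intro β b h
    rw [hσ', Measure.restrict_smul, integral_smul_measure, e.measurableEmbedding.setIntegral_map,
      rescaling_preimage_closedBall x₀ hr, ENNReal.toReal_ofReal (by positivity), smul_eq_mul,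
      inv_mul_le_iff₀ hs, mul_comm s]
    simpa only [Homeomorph.symm_apply_apply] using h
  have hfin := key σ' (fun y => β₁ (e.symm y)) (fun y => β₂ (e.symm y)) (e.symm ⁻¹' K)
    (hβ₁.comp_measurable e.symm.measurable) (fun x => hβ₁1 _) (hc₁.rescale x₀ hr.ne' _)
    (hβ₂.comp_measurable e.symm.measurable) (fun x => hβ₂1 _) (hc₂.rescale x₀ hr.ne' _)
    (by
      rw [← ofReal_measureReal]
      refine ENNReal.ofReal_le_ofReal ?_
      rw [hreal, rescaling_preimage_closedBall x₀ hr, inv_mul_le_iff₀ hs, mul_comm s]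
      exact h5) (hint β₁ b₁ h1) (hint β₂ b₂ h2) (e.symm.isCompact_preimage.2 hK)
    (by
      intro y hy
      have h3 := hKs hy
      have h4 := rescaling_preimage_closedBall x₀ hr 1
      rw [one_mul] at h4
      rw [← h4, mem_preimage] at h3
      simpa [he] using h3)
    (by
      have h3 : e.symm ⁻¹' K = (fun y => r • y) ⁻¹' ((fun y => x₀ + y) ⁻¹' K) := rfl
      rw [h3, Measure.addHaar_preimage_smul _ hr.ne', measure_preimage_add, hK0, mul_zero])
  rw [hreal, ← preimage_comp, show e.symm ∘ e = id from e.symm_comp_self, preimage_id,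
    inv_mul_lt_iff₀ hs] at hfin
  linarith

theorem eventually_mul_pow_le_measureReal {σ : Measure E} [IsFiniteMeasure σ] {x : E} {l : ℝ≥0∞}
    (hl : l < ∞) (hlim : Tendsto (fun r => volume (closedBall x r) / σ (closedBall x r)) (𝓝[>] 0)
      (𝓝 l)) :
    ∃ c : ℝ, 0 < c ∧ ∀ᶠ r in 𝓝[>] 0, c * r ^ Module.finrank ℝ E ≤ σ.real (closedBall x r) := by
  set ω := volume.real (ball (0 : E) 1) with hω
  have hω0 : 0 < ω := ENNReal.toReal_pos (measure_ball_pos _ _ one_pos).ne' measure_ball_lt_top.ne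
  obtain ⟨D, hlD, hD⟩ := ENNReal.lt_iff_exists_nnreal_btwn.1 hl
  have hD0 : 0 < D := ENNReal.coe_pos.1 (zero_le.trans_lt hlD)
  refine ⟨ω / D, by positivity, ?_⟩
  filter_upwards [hlim.eventually (gt_mem_nhds hlD), self_mem_nhdsWithin] with r hr hr0
  rw [mem_Ioi] at hr0
  have hv : volume (closedBall x r) ≠ 0 := (measure_closedBall_pos _ _ hr0).ne'
  have hv' : volume (closedBall x r) ≠ ∞ := measure_closedBall_lt_top.ne
  have h1 : volume (closedBall x r) ≤ D * σ (closedBall x r) :=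
    (ENNReal.div_le_iff_le_mul (Or.inr ENNReal.coe_ne_top) (Or.inl (measure_ne_top _ _))).1 hr.le
  have h2 := ENNReal.toReal_mono (ENNReal.mul_ne_top ENNReal.coe_ne_top (measure_ne_top _ _)) h1
  rw [ENNReal.toReal_mul, ENNReal.coe_toReal, Measure.addHaar_closedBall _ _ hr0.le,
    ENNReal.toReal_mul, ENNReal.toReal_ofReal (by positivity), ← measureReal_def,
    ← measureReal_def, ← hω] at h2
  rw [div_mul_eq_mul_div, div_le_iff₀ (by positivity)]
  linarith

theorem eventually_setIntegral_le {σ : Measure E} [IsFiniteMeasure σ] {β : E → E}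
    (hβ : StronglyMeasurable β) {x : E}
    (hlim : Tendsto (fun r => (∫⁻ y in closedBall x r, ‖β y - β x‖ₑ ∂σ) / σ (closedBall x r))
      (𝓝[>] 0) (𝓝 0)) {ε : ℝ} (hε : 0 < ε) :
    ∀ᶠ r in 𝓝[>] 0, ∫ y in closedBall x r, ‖β y - β x‖ ∂σ ≤ ε * σ.real (closedBall x r) := by
  filter_upwards [hlim.eventually (gt_mem_nhds (ENNReal.ofReal_pos.2 hε))] with r hr
  have h1 : ∫⁻ y in closedBall x r, ‖β y - β x‖ₑ ∂σ ≤ ENNReal.ofReal ε * σ (closedBall x r) := by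
    by_cases h0 : σ (closedBall x r) = 0
    · rw [setLIntegral_measure_zero _ _ h0]
      exact zero_le
    · exact (ENNReal.div_le_iff h0 (measure_ne_top _ _)).1 hr.le
  have h2 := integral_norm_eq_lintegral_enorm (μ := σ.restrict (closedBall x r))
    (hβ.sub (stronglyMeasurable_const (b := β x))).aestronglyMeasurable
  simp only [Pi.sub_apply] at h2
  rw [h2]
  refine ENNReal.toReal_le_of_le_ofReal (by positivity) (h1.trans (le_of_eq ?_))
  rw [ENNReal.ofReal_mul hε.le, ofReal_measureReal]

theorem eventually_half_lt_measureReal_inter {σ : Measure E} [IsFiniteMeasure σ] {N : Set E} {x : E}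
    (hlim : Tendsto (fun r => σ (N ∩ closedBall x r) / σ (closedBall x r)) (𝓝[>] 0) (𝓝 1)) :
    ∀ᶠ r in 𝓝[>] 0, 0 < σ.real (closedBall x r) →
      σ.real (closedBall x r) / 2 < σ.real (N ∩ closedBall x r) := by
  filter_upwards [hlim.eventually (lt_mem_nhds (ENNReal.one_half_lt_one))] with r hr h0
  have h0' : σ (closedBall x r) ≠ 0 := (ENNReal.toReal_pos_iff.1 h0).1.ne'
  have h1 := (ENNReal.lt_div_iff_mul_lt (Or.inl h0') (Or.inl (measure_ne_top _ _))).1 hr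
  have h2 := ENNReal.toReal_strict_mono (measure_ne_top _ _) h1
  rw [ENNReal.toReal_mul] at h2
  simp only [← measureReal_def] at h2
  simp at h2
  linarith

/-- The polars of two curl-free vector-valued measures are parallel almost everywhere on a
Lebesgue-null set. -/
theorem ae_not_linearIndependent {σ : Measure E} [IsFiniteMeasure σ] {β₁ β₂ : E → E}
    (hβ₁ : StronglyMeasurable β₁) (hβ₁1 : ∀ x, ‖β₁ x‖ ≤ 1) (hc₁ : IsCurlFree σ β₁)
    (hβ₂ : StronglyMeasurable β₂) (hβ₂1 : ∀ x, ‖β₂ x‖ ≤ 1) (hc₂ : IsCurlFree σ β₂)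
    {N : Set E} (hN : MeasurableSet N) (hN0 : volume N = 0) :
    ∀ᵐ x ∂σ, x ∈ N → ¬ LinearIndependent ℝ ![β₁ x, β₂ x] := by
  have hi : ∀ β : E → E, StronglyMeasurable β → (∀ x, ‖β x‖ ≤ 1) → Integrable β σ := fun β h h' =>
    Integrable.of_bound h.aestronglyMeasurable 1 (Eventually.of_forall h')
  have hdens : ∀ᵐ x ∂σ, x ∈ N →
      Tendsto (fun r => σ (N ∩ closedBall x r) / σ (closedBall x r)) (𝓝[>] 0) (𝓝 1) :=
    (ae_restrict_iff' hN).1 (Besicovitch.ae_tendsto_measure_inter_div σ N)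
  filter_upwards [hdens, Besicovitch.ae_tendsto_rnDeriv volume σ, Measure.rnDeriv_lt_top volume σ,
    (Besicovitch.vitaliFamily σ).ae_tendsto_lintegral_enorm_sub_div_of_integrable (hi β₁ hβ₁ hβ₁1),
    (Besicovitch.vitaliFamily σ).ae_tendsto_lintegral_enorm_sub_div_of_integrable (hi β₂ hβ₂ hβ₂1)]
    with x hx1 hx2 hx3 hx4 hx5 hxN hlin
  obtain ⟨c, hc, hcm⟩ := eventually_mul_pow_le_measureReal hx3 hx2
  set n := Module.finrank ℝ E with hn
  obtain ⟨ε, hε, key⟩ := exists_measureReal_lt_of_doubling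
    (C₀ := 2 * 8 ^ n) (by positivity) hlin
  have hε' : 0 < ε / (2 * 8 ^ n) := by positivity
  have h8 : Tendsto (fun r : ℝ => 8 * r) (𝓝[>] 0) (𝓝[>] 0) := by
    refine tendsto_nhdsWithin_iff.2 ⟨?_, ?_⟩
    · have : Tendsto (fun r : ℝ => 8 * r) (𝓝 0) (𝓝 (8 * 0)) := tendsto_id.const_mul 8
      rw [mul_zero] at this
      exact this.mono_left nhdsWithin_le_nhds
    · filter_upwards [self_mem_nhdsWithin] with r hr
      exact mul_pos (by norm_num : (0 : ℝ) < 8) hr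
  have e4 := h8.eventually (eventually_setIntegral_le hβ₁
    (hx4.comp (Besicovitch.tendsto_filterAt σ x)) hε')
  have e5 := h8.eventually (eventually_setIntegral_le hβ₂
    (hx5.comp (Besicovitch.tendsto_filterAt σ x)) hε')
  have e1 := eventually_half_lt_measureReal_inter (hx1 hxN)
  obtain ⟨r, hdoub, h4, h5, h1, h2, hr⟩ := ((frequently_doubling
    (m := fun r => σ.real (closedBall x r)) hc n hcm).and_eventually
    (e4.and (e5.and (e1.and (hcm.and self_mem_nhdsWithin))))).exists
  replace hr : 0 < r := hr
  have hs : 0 < σ.real (closedBall x r) := lt_of_lt_of_le (by positivity) h2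
  have hmono : ∀ β : E → E, StronglyMeasurable β → (∀ x, ‖β x‖ ≤ 1) →
      ∫ y in closedBall x (8 * r), ‖β y - β x‖ ∂σ ≤
        ε / (2 * 8 ^ n) * σ.real (closedBall x (8 * r)) →
      ∫ y in closedBall x (3 * r), ‖β y - β x‖ ∂σ ≤ ε * σ.real (closedBall x r) := by
    intro β h h' hle
    have hint : Integrable (fun y => ‖β y - β x‖) σ := ((hi β h h').sub (integrable_const _)).norm
    refine (setIntegral_mono_set hint.integrableOn (Eventually.of_forall fun _ => norm_nonneg _)
      (closedBall_subset_closedBall (by linarith)).eventuallyLE).trans (hle.trans ?_)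
    calc _ ≤ ε / (2 * 8 ^ n) * (2 * 8 ^ n * σ.real (closedBall x r)) :=
          mul_le_mul_of_nonneg_left hdoub hε'.le
      _ = _ := by field_simp
  have hlt : ∀ K, IsCompact K → K ⊆ N ∩ closedBall x r →
      σ.real K < σ.real (closedBall x r) / 2 := fun K hK hKs =>
    key σ β₁ β₂ K hβ₁ hβ₁1 hc₁ hβ₂ hβ₂1 hc₂ x r hr hs
      ((measureReal_mono (closedBall_subset_closedBall (by linarith))).trans hdoub)
      (hmono β₁ hβ₁ hβ₁1 h4) (hmono β₂ hβ₂ hβ₂1 h5) hK (hKs.trans inter_subset_right)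
      (measure_mono_null (hKs.trans inter_subset_left) hN0)
  obtain ⟨K, hKs, hK, hσK⟩ :=
    (hN.inter (measurableSet_closedBall (x := x) (ε := r))).exists_lt_isCompact_of_ne_top
    (measure_ne_top σ _) (r := ENNReal.ofReal (σ.real (closedBall x r) / 2)) (by
      rw [← ofReal_measureReal]
      exact (ENNReal.ofReal_lt_ofReal_iff_of_nonneg (by positivity)).2 (h1 hs))
  rw [← ofReal_measureReal, ENNReal.ofReal_lt_ofReal_iff_of_nonneg (by positivity)] at hσK
  exact (hlt K hK hKs).not_gt hσK

/-- A curl-free vector-valued measure can be represented with respect to a larger measure. -/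
theorem IsCurlFree.exists_of_le {ρ σ : Measure E} [IsFiniteMeasure ρ] [IsFiniteMeasure σ]
    (hρσ : ρ ≤ σ) {a : E → E} (ha : AEStronglyMeasurable a ρ) (ha1 : ∀ᵐ x ∂ρ, ‖a x‖ ≤ 1)
    (hcurl : IsCurlFree ρ a) :
    ∃ β : E → E, StronglyMeasurable β ∧ (∀ x, ‖β x‖ ≤ 1) ∧ IsCurlFree σ β ∧
      ∀ᵐ x ∂ρ, ∃ t : ℝ, 0 < t ∧ β x = t • a x := by
  have hac : ρ ≪ σ := Measure.absolutelyContinuous_of_le hρσ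
  set a' := ha.mk a with ha'
  have ha'm : StronglyMeasurable a' := ha.stronglyMeasurable_mk
  set S : Set E := {x | ‖a' x‖ ≤ 1} with hS
  have hSm : MeasurableSet S := ha'm.norm.measurable measurableSet_Iic
  set q : E → ℝ := fun x => min (ρ.rnDeriv σ x).toReal 1 with hq
  have hqm : Measurable q := (Measure.measurable_rnDeriv ρ σ).ennreal_toReal.min measurable_const
  have hq0 : ∀ x, 0 ≤ q x := fun x => le_min ENNReal.toReal_nonneg zero_le_one
  have hae : ∀ᵐ x ∂ρ, S.indicator a' x = a x := by
    filter_upwards [ha.ae_eq_mk, ha1] with x hx hx1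
    have hxS : x ∈ S := by
      rw [hS, mem_ofPred_eq, ha', ← hx]
      exact hx1
    rw [indicator_of_mem hxS, ha', ← hx]
  have hq1 : ∀ᵐ x ∂σ, q x = (ρ.rnDeriv σ x).toReal := by
    filter_upwards [Measure.rnDeriv_le_one_of_le hρσ] with x hx
    exact min_eq_left (ENNReal.toReal_le_of_le_ofReal zero_le_one (by simpa using hx))
  refine ⟨fun x => q x • S.indicator a' x, hqm.stronglyMeasurable.smul (ha'm.indicator hSm),
    fun x => ?_, ?_, ?_⟩
  · rw [norm_smul, Real.norm_of_nonneg (hq0 x)]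
    refine mul_le_one₀ (min_le_right _ _) (norm_nonneg _) ?_
    by_cases hx : x ∈ S
    · rw [indicator_of_mem hx]
      exact hx
    · rw [indicator_of_notMem hx, norm_zero]
      exact zero_le_one
  · intro φ hφ hφc v w
    rw [← hcurl φ hφ hφc v w, ← integral_rnDeriv_smul hac]
    have h1 : ∀ᵐ x ∂σ, ρ.rnDeriv σ x ≠ 0 → S.indicator a' x = a x := by
      have h2 : ∀ᵐ x ∂(σ.withDensity (ρ.rnDeriv σ)), S.indicator a' x = a x := by
        rwa [Measure.withDensity_rnDeriv_eq _ _ hac]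
      exact (ae_withDensity_iff (Measure.measurable_rnDeriv ρ σ)).1 h2
    refine integral_congr_ae ?_
    filter_upwards [h1, hq1] with x hx hx1
    simp only [inner_smul_left, smul_eq_mul, hx1]
    by_cases h0 : ρ.rnDeriv σ x = 0
    · simp [h0]
    · rw [hx h0]
      simp only [conj_trivial]
      ring
  · filter_upwards [hae, hac.ae_le hq1, Measure.rnDeriv_pos hac,
      hac.ae_le (Measure.rnDeriv_lt_top ρ σ)] with x hx hx1 hx2 hx3
    refine ⟨q x, ?_, by rw [hx]⟩
    rw [hx1]
    exact ENNReal.toReal_pos hx2.ne' hx3.ne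

/-- Polars of two curl-free vector-valued measures are parallel almost everywhere with respect to
a singular measure that is absolutely continuous with respect to both. -/
theorem ae_not_linearIndependent_of_absolutelyContinuous {ρ₁ ρ₂ ν : Measure E}
    [IsFiniteMeasure ρ₁] [IsFiniteMeasure ρ₂] {a₁ a₂ : E → E} (ha₁ : AEStronglyMeasurable a₁ ρ₁)
    (ha₁1 : ∀ᵐ x ∂ρ₁, ‖a₁ x‖ ≤ 1) (hc₁ : IsCurlFree ρ₁ a₁) (ha₂ : AEStronglyMeasurable a₂ ρ₂)
    (ha₂1 : ∀ᵐ x ∂ρ₂, ‖a₂ x‖ ≤ 1) (hc₂ : IsCurlFree ρ₂ a₂) (h₁ : ν ≪ ρ₁) (h₂ : ν ≪ ρ₂)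
    (hν : ν ⟂ₘ volume) : ∀ᵐ x ∂ν, ¬ LinearIndependent ℝ ![a₁ x, a₂ x] := by
  have hle₁ : ρ₁ ≤ ρ₁ + ρ₂ := Measure.le_add_right le_rfl
  have hle₂ : ρ₂ ≤ ρ₁ + ρ₂ := Measure.le_add_left le_rfl
  obtain ⟨β₁, hβ₁, hβ₁1, hcβ₁, hp₁⟩ := hc₁.exists_of_le hle₁ ha₁ ha₁1
  obtain ⟨β₂, hβ₂, hβ₂1, hcβ₂, hp₂⟩ := hc₂.exists_of_le hle₂ ha₂ ha₂1
  obtain ⟨N, hN, hνN, hvN⟩ := hν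
  have key := ae_not_linearIndependent hβ₁ hβ₁1 hcβ₁ hβ₂ hβ₂1 hcβ₂ hN.compl hvN
  have hνN' : ∀ᵐ x ∂ν, x ∈ Nᶜ := by
    rw [ae_iff]
    simpa using hνN
  filter_upwards [(h₁.trans (Measure.absolutelyContinuous_of_le hle₁)).ae_le key, h₁.ae_le hp₁,
    h₂.ae_le hp₂, hνN'] with x hx hx1 hx2 hxN hlin
  obtain ⟨t₁, ht₁, e₁⟩ := hx1
  obtain ⟨t₂, ht₂, e₂⟩ := hx2
  refine hx hxN ?_
  rw [e₁, e₂]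
  rw [LinearIndependent.pair_iff] at hlin ⊢
  intro s t hst
  have := hlin (s * t₁) (t * t₂) (by rwa [← smul_smul, ← smul_smul])
  exact ⟨(mul_eq_zero.1 this.1).resolve_right ht₁.ne', (mul_eq_zero.1 this.2).resolve_right ht₂.ne'⟩

end Euclidean

theorem vecOfCoords_eq_sum {m : ℕ} (c : Finset (Fin (m + 1)) → ℝ) :
    vecOfCoords m c = ∑ j : Fin (m + 1), c {j}ᶜ • ExteriorAlgebra.ιMulti ℝ m fun i =>
      EuclideanSpace.single (j.succAbove i) (1 : ℝ) := by
  have hcard : ∀ j : Fin (m + 1), ({j}ᶜ : Finset (Fin (m + 1))).card = m := fun j => by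
    simp [Finset.card_compl]
  symm
  refine Fintype.sum_bijective
    (fun j => (⟨{j}ᶜ, hcard j⟩ : {s : Finset (Fin (m + 1)) // s.card = m}))
    ⟨fun i j h => ?_, fun ⟨s, hs⟩ => ?_⟩ _ _ fun j => ?_
  · simpa using h
  · have : sᶜ.card = 1 := by simp [Finset.card_compl, hs]
    obtain ⟨j, hj⟩ := Finset.card_eq_one.1 this
    exact ⟨j, by simp [← hj]⟩
  · congr 2
    funext i
    rw [Finset.coe_orderIsoOfFin_apply, Finset.orderEmbOfFin_compl_singleton_apply]
    rfl

/-- The Hodge dual of the `(d - 1)`-vector with coordinates `c`. -/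
noncomputable def dualVector {d : ℕ} (c : Finset (Fin d) → ℝ) : EuclideanSpace ℝ (Fin d) :=
  WithLp.toLp 2 fun j => (-1) ^ (j : ℕ) * c {j}ᶜ

@[simp]
theorem dualVector_apply {d : ℕ} (c : Finset (Fin d) → ℝ) (j : Fin d) :
    dualVector c j = (-1) ^ (j : ℕ) * c {j}ᶜ := rfl

/-- The alternating map `v ↦ ∑ j, (-1) ^ j ⟪u, v j⟫ v₀ ∧ ⋯ ∧ vₘ`, with `v j` omitted from the wedge
product. -/
noncomputable def interiorProduct {m : ℕ} (u : EuclideanSpace ℝ (Fin (m + 1))) :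
    EuclideanSpace ℝ (Fin (m + 1)) [⋀^Fin (m + 1)]→ₗ[ℝ]
      ExteriorAlgebra ℝ (EuclideanSpace ℝ (Fin (m + 1))) :=
  AlternatingMap.alternatizeUncurryFin
    ((innerₛₗ ℝ u).smulRight (ExteriorAlgebra.ιMulti ℝ m))

theorem interiorProduct_apply {m : ℕ} (u : EuclideanSpace ℝ (Fin (m + 1)))
    (v : Fin (m + 1) → EuclideanSpace ℝ (Fin (m + 1))) :
    interiorProduct u v = ∑ j : Fin (m + 1), (-1 : ℤ) ^ (j : ℕ) • ⟪u, v j⟫_ℝ •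
      ExteriorAlgebra.ιMulti ℝ m (j.removeNth v) := by
  rw [interiorProduct, AlternatingMap.alternatizeUncurryFin_apply]
  rfl

theorem vecOfCoords_eq_interiorProduct {m : ℕ} (c : Finset (Fin (m + 1)) → ℝ) :
    vecOfCoords m c =
      interiorProduct (dualVector c) fun j => EuclideanSpace.single j (1 : ℝ) := by
  rw [vecOfCoords_eq_sum, interiorProduct_apply]
  refine Finset.sum_congr rfl fun j _ => ?_
  have : ⟪dualVector c, EuclideanSpace.single j (1 : ℝ)⟫_ℝ = (-1) ^ (j : ℕ) * c {j}ᶜ := by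
    simp [EuclideanSpace.inner_single_right]
  rw [this, ← Int.cast_smul_eq_zsmul ℝ, smul_smul, ← mul_assoc]
  push_cast
  rw [← mul_pow]
  norm_num
  rfl

theorem interiorProduct_mem_span {m : ℕ} {u : EuclideanSpace ℝ (Fin (m + 1))} (hu : u ≠ 0)
    (v : Fin (m + 1) → EuclideanSpace ℝ (Fin (m + 1))) :
    interiorProduct u v ∈ Submodule.span ℝ (simpleVectorsOf m (ℝ ∙ u)ᗮ) := by
  have : Fact (Module.finrank ℝ (EuclideanSpace ℝ (Fin (m + 1))) = m + 1) := ⟨by simp⟩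
  have hrank : Module.finrank ℝ (ℝ ∙ u)ᗮ = m := Submodule.finrank_orthogonal_span_singleton hu
  let f := Module.finBasisOfFinrankEq ℝ (ℝ ∙ u)ᗮ hrank
  have hli : LinearIndependent ℝ (Fin.cons u fun i => (f i : EuclideanSpace ℝ (Fin (m + 1))) :
      Fin (m + 1) → EuclideanSpace ℝ (Fin (m + 1))) := by
    rw [linearIndependent_finCons]
    refine ⟨f.linearIndependent.map' (ℝ ∙ u)ᗮ.subtype (by simp), fun hmem => hu ?_⟩
    have h1 : u ∈ (ℝ ∙ u)ᗮ := by
      refine Submodule.span_le.2 ?_ hmem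
      rintro _ ⟨i, rfl⟩
      exact (f i).2
    simpa using Submodule.mem_orthogonal_singleton_iff_inner_right.1 h1
  let b := basisOfLinearIndependentOfCardEqFinrank hli (by simp)
  have hb : (b : Fin (m + 1) → EuclideanSpace ℝ (Fin (m + 1))) =
      Fin.cons u fun i => (f i : EuclideanSpace ℝ (Fin (m + 1))) :=
    coe_basisOfLinearIndependentOfCardEqFinrank hli (by simp)
  have hΦb : interiorProduct u b ∈ Submodule.span ℝ (simpleVectorsOf m (ℝ ∙ u)ᗮ) := by
    rw [interiorProduct_apply, hb, Fin.sum_univ_succ]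
    refine Submodule.add_mem _ ?_ (Submodule.sum_mem _ fun j _ => ?_)
    · rw [← Int.cast_smul_eq_zsmul ℝ]
      refine Submodule.smul_mem _ _ (Submodule.smul_mem _ _ (Submodule.subset_span ?_))
      exact ⟨fun i => f i, fun i => (f i).2, by congr 1⟩
    · have : ⟪u, (f j : EuclideanSpace ℝ (Fin (m + 1)))⟫_ℝ = 0 :=
        Submodule.mem_orthogonal_singleton_iff_inner_right.1 (f j).2
      simp [this]
  have key : interiorProduct u = (b.det).smulRight (interiorProduct u b) := by
    refine b.ext_alternating fun w hw => ?_
    let σ : Equiv.Perm (Fin (m + 1)) :=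
      Equiv.ofBijective w (Finite.injective_iff_bijective.1 hw)
    change interiorProduct u (b ∘ σ) = b.det.smulRight (interiorProduct u b) (b ∘ σ)
    simp [AlternatingMap.map_perm, Module.Basis.det_self]
  rw [key]
  exact Submodule.smul_mem _ _ hΦb

theorem norm_dualVector {d : ℕ} (hd : d ≠ 0) {c : Finset (Fin d) → ℝ}
    (hc : ∀ s, s.card ≠ d - 1 → c s = 0) (h1 : ∑ s, c s ^ 2 = 1) : ‖dualVector c‖ = 1 := by
  have hsum : ∑ j : Fin d, c {j}ᶜ ^ 2 = ∑ s, c s ^ 2 := by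
    refine Fintype.sum_of_injective (fun j : Fin d => ({j}ᶜ : Finset (Fin d)))
      (fun i j h => by simpa using h) _ _ (fun s hs => ?_) fun j => rfl
    rw [hc s fun hcard => hs ?_]
    · simp
    · have : sᶜ.card = 1 := by
        rw [Finset.card_compl, hcard, Fintype.card_fin]
        omega
      obtain ⟨j, hj⟩ := Finset.card_eq_one.1 this
      exact ⟨j, by simp [← hj]⟩
  rw [EuclideanSpace.norm_eq, Real.sqrt_eq_one, ← h1, ← hsum]
  refine Finset.sum_congr rfl fun j _ => ?_
  simp

theorem vecOfCoords_mem_span {d : ℕ} (hd : d ≠ 0) {c : Finset (Fin d) → ℝ}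
    {u : EuclideanSpace ℝ (Fin d)} (hu : u ≠ 0) {s : ℝ} (hs : dualVector c = s • u) :
    vecOfCoords (d - 1) c ∈ Submodule.span ℝ (simpleVectorsOf (d - 1) (ℝ ∙ u)ᗮ) := by
  obtain ⟨m, rfl⟩ := Nat.exists_eq_succ_of_ne_zero hd
  change vecOfCoords m c ∈ Submodule.span ℝ (simpleVectorsOf m (ℝ ∙ u)ᗮ)
  have : interiorProduct (dualVector c) (fun j => EuclideanSpace.single j (1 : ℝ)) =
      s • interiorProduct u (fun j => EuclideanSpace.single j (1 : ℝ)) := by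
    rw [hs, interiorProduct_apply, interiorProduct_apply, Finset.smul_sum]
    refine Finset.sum_congr rfl fun j _ => ?_
    rw [real_inner_smul_left, mul_smul, smul_comm s ((-1 : ℤ) ^ (j : ℕ))]
  rw [vecOfCoords_eq_interiorProduct, this]
  exact Submodule.smul_mem _ _ (interiorProduct_mem_span hu _)

theorem vecOfCoords_zero_mem_span {d : ℕ} (c : Finset (Fin d) → ℝ)
    (V : Submodule ℝ (EuclideanSpace ℝ (Fin d))) :
    vecOfCoords 0 c ∈ Submodule.span ℝ (simpleVectorsOf 0 V) :=
  Submodule.sum_mem _ fun _ _ => Submodule.smul_mem _ _ <| Submodule.subset_span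
    ⟨_, fun j => j.elim0, rfl⟩

theorem aestronglyMeasurable_dualVector {d : ℕ} {ρ : Measure (EuclideanSpace ℝ (Fin d))}
    {F : EuclideanSpace ℝ (Fin d) → Finset (Fin d) → ℝ} (hF : AEStronglyMeasurable F ρ) :
    AEStronglyMeasurable (fun x => dualVector (F x)) ρ := by
  have : Continuous (dualVector : (Finset (Fin d) → ℝ) → EuclideanSpace ℝ (Fin d)) := by
    unfold dualVector
    fun_prop
  exact this.comp_aestronglyMeasurable hF

theorem wedgeSign_compl_pair_left {d : ℕ} {j k : Fin d} (h : j < k) :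
    wedgeSign j ({j, k}ᶜ : Finset (Fin d)) = (-1) ^ (j : ℕ) := by
  have : (({j, k}ᶜ : Finset (Fin d)).filter fun l => l < j) = Finset.Iio j := by
    ext l
    simp only [Finset.mem_filter, Finset.mem_compl, Finset.mem_insert, Finset.mem_singleton,
      Finset.mem_Iio]
    omega
  rw [wedgeSign, this, Fin.card_Iio]

theorem wedgeSign_compl_pair_right {d : ℕ} {j k : Fin d} (h : j < k) :
    wedgeSign k ({j, k}ᶜ : Finset (Fin d)) = -(-1) ^ (k : ℕ) := by
  have : (({j, k}ᶜ : Finset (Fin d)).filter fun l => l < k) = (Finset.Iio k).erase j := by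
    ext l
    simp only [Finset.mem_filter, Finset.mem_compl, Finset.mem_insert, Finset.mem_singleton,
      Finset.mem_Iio, Finset.mem_erase]
    omega
  rw [wedgeSign, this, Finset.card_erase_of_mem (by simpa using h), Fin.card_Iio]
  obtain ⟨n, hn⟩ := Nat.exists_eq_succ_of_ne_zero (show (k : ℕ) ≠ 0 by
    have : (j : ℕ) < k := h
    omega)
  rw [hn]
  simp [pow_succ]

theorem integral_pderiv_dualVector_of_lt {d : ℕ} {ρ : Measure (EuclideanSpace ℝ (Fin d))}
    {F : EuclideanSpace ℝ (Fin d) → Finset (Fin d) → ℝ} {φ : EuclideanSpace ℝ (Fin d) → ℝ}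
    (hb : ∀ t : Finset (Fin d), t.card + 1 = d - 1 →
      ∑ j ∈ tᶜ, wedgeSign j t * ∫ x, pderiv' j φ x * F x (insert j t) ∂ρ = 0)
    {j k : Fin d} (h : j < k) :
    ∫ x, pderiv' j φ x * dualVector (F x) k ∂ρ = ∫ x, pderiv' k φ x * dualVector (F x) j ∂ρ := by
  have hjk : (j : ℕ) < k := h
  have hcard : ({j, k}ᶜ : Finset (Fin d)).card + 1 = d - 1 := by
    rw [Finset.card_compl, Finset.card_pair h.ne, Fintype.card_fin]
    omega
  have hj : insert j ({j, k}ᶜ : Finset (Fin d)) = {k}ᶜ := by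
    ext l
    simp only [Finset.mem_insert, Finset.mem_compl, Finset.mem_singleton]
    omega
  have hk : insert k ({j, k}ᶜ : Finset (Fin d)) = {j}ᶜ := by
    ext l
    simp only [Finset.mem_insert, Finset.mem_compl, Finset.mem_singleton]
    omega
  have key := hb _ hcard
  rw [compl_compl, Finset.sum_pair h.ne, hj, hk, wedgeSign_compl_pair_left h,
    wedgeSign_compl_pair_right h] at key
  simp only [dualVector_apply, mul_left_comm _ ((-1 : ℝ) ^ _), integral_const_mul]
  have hsq : ∀ n : ℕ, ((-1 : ℝ) ^ n) * (-1) ^ n = 1 := fun n => by rw [← mul_pow]; norm_num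
  linear_combination (-1) ^ (j : ℕ) * (-1) ^ (k : ℕ) * key
    - (-1) ^ (k : ℕ) * (∫ x, pderiv' j φ x * F x {k}ᶜ ∂ρ) * hsq j
    + (-1) ^ (j : ℕ) * (∫ x, pderiv' k φ x * F x {j}ᶜ ∂ρ) * hsq k

theorem integral_pderiv_dualVector {d : ℕ} {ρ : Measure (EuclideanSpace ℝ (Fin d))}
    {F : EuclideanSpace ℝ (Fin d) → Finset (Fin d) → ℝ} {φ : EuclideanSpace ℝ (Fin d) → ℝ}
    (hb : ∀ t : Finset (Fin d), t.card + 1 = d - 1 →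
      ∑ j ∈ tᶜ, wedgeSign j t * ∫ x, pderiv' j φ x * F x (insert j t) ∂ρ = 0) (j k : Fin d) :
    ∫ x, pderiv' j φ x * dualVector (F x) k ∂ρ = ∫ x, pderiv' k φ x * dualVector (F x) j ∂ρ := by
  rcases lt_trichotomy j k with h | rfl | h
  · exact integral_pderiv_dualVector_of_lt hb h
  · rfl
  · exact (integral_pderiv_dualVector_of_lt hb h).symm

theorem isCurlFree_dualVector {d : ℕ} {ρ : Measure (EuclideanSpace ℝ (Fin d))} [IsFiniteMeasure ρ]
    {F : EuclideanSpace ℝ (Fin d) → Finset (Fin d) → ℝ} (hF : AEStronglyMeasurable F ρ)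
    (hF1 : ∀ᵐ x ∂ρ, ‖dualVector (F x)‖ ≤ 1)
    (hb : ∀ φ : EuclideanSpace ℝ (Fin d) → ℝ, ContDiff ℝ (⊤ : ℕ∞) φ → HasCompactSupport φ →
      ∀ t : Finset (Fin d), t.card + 1 = d - 1 →
        ∑ j ∈ tᶜ, wedgeSign j t * ∫ x, pderiv' j φ x * F x (insert j t) ∂ρ = 0) :
    IsCurlFree ρ fun x => dualVector (F x) := by
  intro φ hφ hφc v w
  have hint : ∀ j k : Fin d, Integrable (fun x => pderiv' j φ x * dualVector (F x) k) ρ := by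
    intro j k
    have hcont : Continuous (pderiv' j φ) :=
      (hφ.continuous_fderiv (by simp)).clm_apply continuous_const
    have hcs : HasCompactSupport (pderiv' j φ) := by
      unfold pderiv'
      exact (hφc.fderiv (𝕜 := ℝ)).comp_left (g := fun L => L (EuclideanSpace.single j 1)) (by simp)
    refine (hcont.integrable_of_hasCompactSupport hcs).mul_bdd (c := 1) ?_ ?_
    · exact (EuclideanSpace.proj (𝕜 := ℝ) k).continuous.comp_aestronglyMeasurable
        (aestronglyMeasurable_dualVector hF)
    · filter_upwards [hF1] with x hx
      exact (PiLp.norm_apply_le _ k).trans hx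
  have hexp : ∀ x, fderiv ℝ φ x v * ⟪dualVector (F x), w⟫_ℝ
      - fderiv ℝ φ x w * ⟪dualVector (F x), v⟫_ℝ = ∑ j, ∑ k, (v j * w k) *
        (pderiv' j φ x * dualVector (F x) k - pderiv' k φ x * dualVector (F x) j) := by
    intro x
    have hL : ∀ u : EuclideanSpace ℝ (Fin d), fderiv ℝ φ x u = ∑ j, u j * pderiv' j φ x := by
      intro u
      conv_lhs => rw [← (EuclideanSpace.basisFun (Fin d) ℝ).sum_repr u]
      simp [pderiv']
    have hI : ∀ u : EuclideanSpace ℝ (Fin d), ⟪dualVector (F x), u⟫_ℝ =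
        ∑ k, u k * dualVector (F x) k := by
      intro u
      simp only [PiLp.inner_apply]
      rfl
    simp only [hL, hI, Finset.sum_mul_sum, mul_sub, Finset.sum_sub_distrib]
    congr 1
    · refine Finset.sum_congr rfl fun j _ => Finset.sum_congr rfl fun k _ => by ring
    · rw [Finset.sum_comm]
      refine Finset.sum_congr rfl fun j _ => Finset.sum_congr rfl fun k _ => by ring
  have hint' : ∀ j k : Fin d, Integrable (fun x => (v j * w k) *
      (pderiv' j φ x * dualVector (F x) k - pderiv' k φ x * dualVector (F x) j)) ρ :=
    fun j k => ((hint j k).sub (hint k j)).const_mul _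
  simp only [hexp]
  rw [integral_finsetSum _ fun j _ => integrable_finsetSum _ fun k _ => hint' j k]
  refine Finset.sum_eq_zero fun j _ => ?_
  rw [integral_finsetSum _ fun k _ => hint' j k]
  refine Finset.sum_eq_zero fun k _ => ?_
  rw [integral_const_mul, integral_sub (hint j k) (hint k j),
    integral_pderiv_dualVector (hb φ hφ hφc) j k, sub_self, mul_zero]

end RankOne

/-- **Structure theorem for boundaryless `(d−1)`-dimensional normal currents.**
For each `i`, the `(d−1)`-current `T_i` of finite mass on `ℝ^d` is encoded by
`ρ i = ‖T_i‖` and the coordinates `F i x s` (`#s = d−1`) of the orienting vector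
`\vec T_i(x)`, normalized `ρ i`-a.e.; `∂T_i = 0` is tested in coordinates against all
`φ · dx^t` with `#t + 1 = d − 1`.  If `μ` is a finite positive Radon measure with
`μ ≪ ‖T_i‖` for all `i`, then for `μ^s`-a.e. `x` there is a `(d−1)`-dimensional
subspace `V_x ⊆ ℝ^d` with `\vec T_i(x) ∈ Λ_{d−1}(V_x)` for every `i`. -/
theorem statement10 {d r : ℕ}
    (ρ : Fin r → Measure (EuclideanSpace ℝ (Fin d)))
    (hρfin : ∀ i, IsFiniteMeasure (ρ i))
    (F : Fin r → EuclideanSpace ℝ (Fin d) → Finset (Fin d) → ℝ)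
    (hFmeas : ∀ i, AEStronglyMeasurable (F i) (ρ i))
    (hFdim : ∀ i x s, s.card ≠ d - 1 → F i x s = 0)
    (hFpolar : ∀ i, ∀ᵐ x ∂(ρ i), ∑ s : Finset (Fin d), (F i x s) ^ 2 = 1)
    (hboundaryless : ∀ i, ∀ φ : EuclideanSpace ℝ (Fin d) → ℝ,
      ContDiff ℝ (⊤ : ℕ∞) φ → HasCompactSupport φ →
      ∀ t : Finset (Fin d), t.card + 1 = d - 1 →
        ∑ j ∈ tᶜ, wedgeSign j t * ∫ x, pderiv' j φ x * F i x (insert j t) ∂(ρ i) = 0)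
    (μ : Measure (EuclideanSpace ℝ (Fin d))) [IsFiniteMeasure μ]
    (hac : ∀ i, μ ≪ ρ i) :
    ∀ᵐ x ∂(μ.singularPart volume),
      ∃ V : Submodule ℝ (EuclideanSpace ℝ (Fin d)), Module.finrank ℝ V = d - 1 ∧
        ∀ i, vecOfCoords (d - 1) (F i x) ∈
          Submodule.span ℝ (simpleVectorsOf (d - 1) V) := by
  rcases le_or_gt d 1 with hd | hd
  · have h0 : d - 1 = 0 := by omega
    refine ae_of_all _ fun x => ⟨⊥, by simp [h0], fun i => ?_⟩
    rw [h0]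
    exact RankOne.vecOfCoords_zero_mem_span _ _
  have hd0 : d ≠ 0 := by omega
  have : Fact (Module.finrank ℝ (EuclideanSpace ℝ (Fin d)) = d - 1 + 1) := ⟨by
    rw [finrank_euclideanSpace, Fintype.card_fin]
    omega⟩
  have hν : ∀ i, μ.singularPart volume ≪ ρ i := fun i =>
    (Measure.absolutelyContinuous_of_le (μ.singularPart_le volume)).trans (hac i)
  have hnorm : ∀ i, ∀ᵐ x ∂(ρ i), ‖RankOne.dualVector (F i x)‖ = 1 := fun i => by
    filter_upwards [hFpolar i] with x hx
    exact RankOne.norm_dualVector hd0 (hFdim i x) hx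
  have hcurl : ∀ i, RankOne.IsCurlFree (ρ i) fun x => RankOne.dualVector (F i x) := fun i =>
    RankOne.isCurlFree_dualVector (hFmeas i) ((hnorm i).mono fun x hx => hx.le) (hboundaryless i)
  have hpar : ∀ i j, ∀ᵐ x ∂(μ.singularPart volume),
      ¬ LinearIndependent ℝ ![RankOne.dualVector (F i x), RankOne.dualVector (F j x)] := fun i j =>
    RankOne.ae_not_linearIndependent_of_absolutelyContinuous
      (RankOne.aestronglyMeasurable_dualVector (hFmeas i)) ((hnorm i).mono fun x hx => hx.le)
      (hcurl i) (RankOne.aestronglyMeasurable_dualVector (hFmeas j))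
      ((hnorm j).mono fun x hx => hx.le) (hcurl j) (hν i) (hν j)
      (μ.mutuallySingular_singularPart volume)
  have hnorm' := ae_all_iff.2 fun i => (hν i).ae_le (hnorm i)
  filter_upwards [hnorm', ae_all_iff.2 fun i => ae_all_iff.2 (hpar i)] with x hx1 hx2
  rcases isEmpty_or_nonempty (Fin r) with hr | ⟨⟨i₀⟩⟩
  · have hu : (EuclideanSpace.single ⟨0, by omega⟩ 1 : EuclideanSpace ℝ (Fin d)) ≠ 0 := by simp
    exact ⟨_, Submodule.finrank_orthogonal_span_singleton hu, fun i => hr.elim i⟩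
  have hu : RankOne.dualVector (F i₀ x) ≠ 0 := fun h => by simpa [h] using hx1 i₀
  refine ⟨_, Submodule.finrank_orthogonal_span_singleton hu, fun i => ?_⟩
  have hdep := hx2 i₀ i
  rw [LinearIndependent.pair_iff' hu] at hdep
  push Not at hdep
  obtain ⟨s, hs⟩ := hdep
  exact RankOne.vecOfCoords_mem_span hd0 hu hs.symm
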